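/- Let $\hat{T}$ be the reference triangle with vertices $(0,0)$, $(1,0)$, $(1,1)$, $s > 1/2$, and $\mathbf{u} \in \mathbf{H}^s(\hat{T})$ with $\mathrm{div}\,\mathbf{u} \in L^2(\hat{T})$. Then the lowest-order Raviart–Thomas interpolant $\hat{\Pi}_{\mathrm{RT}}\mathbf{u} = (a,b)^\top + c(x_1,x_2)^\top$ satisfies, for $l = 1, 2$, $\|(\hat{\Pi}_{\mathrm{RT}}\mathbf{u})_l\|_{L^2(\hat{T})} \le C\big(\|u_l\|_{H^s(\hat{T})} + \|\mathrm{div}\,\mathbf{u}\|_{L^2(\hat{T})}\big)$ with $C$ independent of $\mathbf{u}$. -/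

import Mathlib

open MeasureTheory Set

noncomputable section

/-- The reference triangle `T̂` with vertices `(0,0)`, `(1,0)`, `(1,1)`. -/
def That : Set (ℝ × ℝ) := {x | 0 < x.1 ∧ x.1 < 1 ∧ 0 < x.2 ∧ x.2 < x.1}

/-- Squared 2D Gagliardo `H^s` seminorm on `D` (Euclidean distance). -/
def gag2Sq (s : ℝ) (D : Set (ℝ × ℝ)) (u : ℝ × ℝ → ℝ) : ℝ :=
  ∫ x in D, ∫ y in D,
    (u x - u y) ^ 2 / ((x.1 - y.1) ^ 2 + (x.2 - y.2) ^ 2) ^ ((2 + 2 * s) / 2)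

/-- `H^s(T̂)` norm. -/
def HsNorm (s : ℝ) (u : ℝ × ℝ → ℝ) : ℝ :=
  Real.sqrt (∫ x in That, u x ^ 2) + Real.sqrt (gag2Sq s That u)

/-- Partial derivatives. -/
def pd1 (φ : ℝ × ℝ → ℝ) (x : ℝ × ℝ) : ℝ := fderiv ℝ φ x (1, 0)
def pd2 (φ : ℝ × ℝ → ℝ) (x : ℝ × ℝ) : ℝ := fderiv ℝ φ x (0, 1)

/-- Green-formula pairing `(u,∇φ)_{0,T̂} + ∫_{T̂}(div u) φ = ⟨u·n, φ⟩_{∂T̂}`,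
defining the weak normal fluxes. -/
def pairing (u1 u2 dv φ : ℝ × ℝ → ℝ) : ℝ :=
  (∫ x in That, (u1 x * pd1 φ x + u2 x * pd2 φ x)) + ∫ x in That, dv x * φ x

/-- Admissible test function `φ ∈ H^{1-ε}(T̂)` with boundary values `w1` on the bottom
edge `ê₁ = {(t,0)}`, `w2` on the vertical edge `ê₂ = {(1,t)}`, `w3` on the oblique
edge `ê₃ = {(t,t)}` (edges without corners), such that the pairing integrals are
defined. -/
structure Adm (ε : ℝ) (u1 u2 dv : ℝ × ℝ → ℝ) (φ : ℝ × ℝ → ℝ)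
    (w1 w2 w3 : ℝ) : Prop where
  diff : DifferentiableOn ℝ φ That
  cont : ContinuousOn φ (closure That \ {(0, 0), (1, 0), (1, 1)})
  bottom : ∀ t ∈ Ioo (0:ℝ) 1, φ (t, 0) = w1
  right : ∀ t ∈ Ioo (0:ℝ) 1, φ (1, t) = w2
  oblique : ∀ t ∈ Ioo (0:ℝ) 1, φ (t, t) = w3
  mem : IntegrableOn
    (fun q : (ℝ × ℝ) × (ℝ × ℝ) =>
      (φ q.1 - φ q.2) ^ 2 /
        ((q.1.1 - q.2.1) ^ 2 + (q.1.2 - q.2.2) ^ 2) ^ ((2 + 2 * (1 - ε)) / 2))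
    (That ×ˢ That)
  memL2 : IntegrableOn (fun x => φ x ^ 2) That
  int1 : IntegrableOn (fun x => u1 x * pd1 φ x + u2 x * pd2 φ x) That
  int2 : IntegrableOn (fun x => dv x * φ x) That

section LipschitzTest

open Filter Topology Metric
open scoped Convolution

variable {E : Type*} [NormedAddCommGroup E] [NormedSpace ℝ E] [MeasurableSpace E]

theorem aestronglyMeasurable_clm_apply {ν : Measure E} {D : E → E →L[ℝ] ℝ} {w : E → E}
    (hD : AEStronglyMeasurable D ν) (hw : AEStronglyMeasurable w ν) :
    AEStronglyMeasurable (fun x => D x (w x)) ν :=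
  isBoundedBilinearMap_apply.continuous.comp_aestronglyMeasurable (hD.prodMk hw)

/-- Lipschitz test functions with compact support in `V`. -/
structure LipTest (V : Set E) (ζ : E → ℝ) : Prop where
  lip : ∃ C, LipschitzWith C ζ
  comp : HasCompactSupport ζ
  sub : tsupport ζ ⊆ V

/-- `g` is the weak divergence of the vector field `w` on `Ω`. -/
def WeakDiv (μ : Measure E) (Ω : Set E) (w : E → E) (g : E → ℝ) : Prop :=
  ∀ ψ : E → ℝ, ContDiff ℝ (⊤ : ℕ∞) ψ → HasCompactSupport ψ → tsupport ψ ⊆ Ω →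
    ∫ x in Ω, (fderiv ℝ ψ x (w x) + g x * ψ x) ∂μ = 0

variable [FiniteDimensional ℝ E] [BorelSpace E] {μ : Measure E} [μ.IsAddHaarMeasure]

theorem fderiv_convolution_of_lipschitz {f : E → ℝ} {C : NNReal} (hf : LipschitzWith C f)
    (φ : ContDiffBump (0 : E)) (x : E) :
    fderiv ℝ (φ.normed μ ⋆[ContinuousLinearMap.lsmul ℝ ℝ, μ] f) x =
      (φ.normed μ ⋆[ContinuousLinearMap.lsmul ℝ ℝ, μ] fderiv ℝ f) x := by
  have hc : Continuous (φ.normed μ) := φ.continuous_normed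
  have hcs : HasCompactSupport (φ.normed μ) := φ.hasCompactSupport_normed
  have hint : Integrable (φ.normed μ) μ := φ.integrable_normed
  have hbd : Continuous fun y => φ.normed μ y * (C : ℝ) := hc.mul continuous_const
  have key := hasFDerivAt_integral_of_dominated_loc_of_lip (μ := μ) (𝕜 := ℝ)
    (F := fun z y => φ.normed μ y * f (z - y))
    (F' := fun y => φ.normed μ y • fderiv ℝ f (x - y)) (x₀ := x) (s := univ)
    (bound := fun y => φ.normed μ y * (C : ℝ)) univ_mem
    (Eventually.of_forall fun z => (hc.mul (hf.continuous.comp (by fun_prop))).aestronglyMeasurable)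
    ?_ ?_ ?_ (hint.mul_const _) ?_
  · have h2 := key.2.fderiv
    exact h2
  · exact (hc.mul (hf.continuous.comp (by fun_prop))).integrable_of_hasCompactSupport hcs.mul_right
  · exact (hc.measurable.smul ((measurable_fderiv ℝ f).comp
      (measurable_const.sub measurable_id))).aestronglyMeasurable
  · refine Eventually.of_forall fun y => LipschitzOnWith.of_dist_le_mul fun a _ b _ => ?_
    rw [Real.dist_eq, ← mul_sub, abs_mul]
    have := hf.dist_le_mul (a - y) (b - y)
    rw [Real.dist_eq, dist_sub_right] at this
    simp only [Real.coe_nnabs, abs_mul, NNReal.abs_eq]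
    rw [mul_assoc]
    gcongr
  · have h1 : ∀ᵐ y ∂μ, DifferentiableAt ℝ f (x - y) := by
      have := hf.ae_differentiableAt (μ := μ)
      exact (quasiMeasurePreserving_sub_left_of_right_invariant μ x).ae this
    filter_upwards [h1] with y hy
    have : HasFDerivAt (fun z => f (z - y)) (fderiv ℝ f (x - y)) x := by
      have := hy.hasFDerivAt.comp x ((hasFDerivAt_id x).sub_const y)
      rwa [ContinuousLinearMap.comp_id] at this
    exact this.const_mul (φ.normed μ y)

theorem norm_convolution_normed_le {F : Type*} [NormedAddCommGroup F] [NormedSpace ℝ F]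
    {f : E → F} {C : ℝ} (hf : ∀ x, ‖f x‖ ≤ C)
    (φ : ContDiffBump (0 : E)) (x : E) :
    ‖(φ.normed μ ⋆[ContinuousLinearMap.lsmul ℝ ℝ, μ] f) x‖ ≤ C := by
  rw [convolution_def]
  calc _ ≤ ∫ y, φ.normed μ y * C ∂μ := by
        refine norm_integral_le_of_norm_le (φ.integrable_normed.mul_const _)
          (Eventually.of_forall fun y => ?_)
        rw [ContinuousLinearMap.lsmul_apply, norm_smul, Real.norm_of_nonneg (φ.nonneg_normed y)]
        exact mul_le_mul_of_nonneg_left (hf _) (φ.nonneg_normed y)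
    _ = C := by rw [integral_mul_const, φ.integral_normed, one_mul]

theorem WeakDiv.lipschitz {Ω : Set E} {w : E → E} {g : E → ℝ}
    (hw : IntegrableOn w Ω μ) (hg : IntegrableOn g Ω μ) (hΩ : IsOpen Ω)
    (hdiv : WeakDiv μ Ω w g) {f : E → ℝ} (hf : LipTest Ω f) :
    ∫ x in Ω, (fderiv ℝ f x (w x) + g x * f x) ∂μ = 0 := by
  obtain ⟨⟨C, hC⟩, hcomp, hsub⟩ := hf
  obtain ⟨δ, hδ, hδΩ⟩ := IsCompact.exists_cthickening_subset_open hcomp hΩ hsub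
  obtain ⟨M, hM⟩ := hcomp.exists_bound_of_continuous hC.continuous
  have hpos : ∀ n : ℕ, 0 < δ / (2 * (n + 1)) := fun n => by positivity
  let φ : ℕ → ContDiffBump (0 : E) := fun n =>
    ⟨δ / (2 * (n + 1)), 2 * (δ / (2 * (n + 1))), hpos n, by linarith [hpos n]⟩
  have hrout : ∀ n, (φ n).rOut = δ / (n + 1) := fun n => by
    change 2 * (δ / (2 * ((n : ℝ) + 1))) = _; field_simp
  have hlim : Tendsto (fun n => (φ n).rOut) atTop (𝓝 0) := by
    simp_rw [hrout]
    simpa [div_eq_mul_inv] using (tendsto_one_div_add_atTop_nhds_zero_nat (𝕜 := ℝ)).const_mul δ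
  have hle : ∀ n, (φ n).rOut ≤ δ := fun n => by
    rw [hrout]; exact div_le_self hδ.le (by linarith [Nat.cast_nonneg (α := ℝ) n])
  let F : ℕ → E → ℝ := fun n => (φ n).normed μ ⋆[ContinuousLinearMap.lsmul ℝ ℝ, μ] f
  have hsupp : ∀ n, tsupport (F n) ⊆ cthickening δ (tsupport f) := by
    intro n
    refine closure_minimal (fun x hx => ?_) isClosed_cthickening
    obtain ⟨a, ha, b, hb, rfl⟩ := Set.mem_add.1 (support_convolution_subset _ hx)
    rw [(φ n).support_normed_eq] at ha
    refine mem_cthickening_of_dist_le _ b _ _ (subset_closure hb) ?_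
    rw [dist_eq_norm, add_sub_cancel_right]
    exact (mem_ball_zero_iff.1 ha).le.trans (hle n)
  have hF0 : ∀ n, ∫ x in Ω, (fderiv ℝ (F n) x (w x) + g x * F n x) ∂μ = 0 := fun n =>
    hdiv _ ((φ n).hasCompactSupport_normed.contDiff_convolution_left _ (φ n).contDiff_normed
      hC.continuous.locallyIntegrable)
      (IsCompact.of_isClosed_subset (IsCompact.cthickening hcomp) (isClosed_tsupport _) (hsupp n))
      ((hsupp n).trans hδΩ)
  have hDb : ∀ x, ‖fderiv ℝ f x‖ ≤ C := fun x => norm_fderiv_le_of_lipschitz ℝ hC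
  have hDl : LocallyIntegrable (fderiv ℝ f) μ := by
    refine (locallyIntegrable_const (C : ℝ)).mono (measurable_fderiv ℝ f).aestronglyMeasurable
      (Eventually.of_forall fun x => ?_)
    simpa using hDb x
  have hr : ∀ᶠ n in atTop, (φ n).rOut ≤ 2 * (φ n).rIn := Eventually.of_forall fun n => le_rfl
  have hD := ContDiffBump.ae_convolution_tendsto_right_of_locallyIntegrable hlim hr hDl
  have hV := ContDiffBump.ae_convolution_tendsto_right_of_locallyIntegrable hlim hr
    (hC.continuous.locallyIntegrable (μ := μ))
  have hT : Tendsto (fun n => ∫ x in Ω, (fderiv ℝ (F n) x (w x) + g x * F n x) ∂μ) atTop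
      (𝓝 (∫ x in Ω, (fderiv ℝ f x (w x) + g x * f x) ∂μ)) := by
    refine tendsto_integral_of_dominated_convergence (fun x => C * ‖w x‖ + ‖g x‖ * M) ?_
      ((hw.norm.const_mul _).add (hg.norm.mul_const _)) ?_ ?_
    · intro n
      have hcd : ContDiff ℝ (⊤ : ℕ∞) (F n) :=
        (φ n).hasCompactSupport_normed.contDiff_convolution_left _ (φ n).contDiff_normed
          hC.continuous.locallyIntegrable
      exact (aestronglyMeasurable_clm_apply
        (hcd.continuous_fderiv (by simp)).aestronglyMeasurable hw.aestronglyMeasurable).add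
        (hg.aestronglyMeasurable.mul hcd.continuous.aestronglyMeasurable)
    · intro n
      refine Eventually.of_forall fun x => (norm_add_le _ _).trans ?_
      gcongr
      · refine (ContinuousLinearMap.le_opNorm _ _).trans ?_
        gcongr
        rw [fderiv_convolution_of_lipschitz hC]
        exact norm_convolution_normed_le hDb _ _
      · rw [norm_mul]
        gcongr
        exact norm_convolution_normed_le hM _ _
    · refine ae_restrict_of_ae ?_
      filter_upwards [hD, hV] with x h1 h2
      refine Tendsto.add ?_ (h2.const_mul _)
      simp_rw [F, fderiv_convolution_of_lipschitz hC]
      exact ((ContinuousLinearMap.apply ℝ ℝ (w x)).continuous.tendsto _).comp h1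
  simp_rw [hF0] at hT
  exact (tendsto_nhds_unique hT tendsto_const_nhds)

end LipschitzTest

section Ramp

open Filter Topology Metric

variable {E : Type*} [NormedAddCommGroup E] [NormedSpace ℝ E]

/-- The cutoff that vanishes at distance at most `r` from `Z` and equals `1` beyond `2 r`. -/
def ramp (Z : Set E) (r : ℝ) (x : E) : ℝ := min 1 (max 0 (infDist x Z / r - 1))

theorem ramp_nonneg (Z : Set E) (r : ℝ) (x : E) : 0 ≤ ramp Z r x :=
  le_min zero_le_one (le_max_left _ _)

theorem ramp_le_one (Z : Set E) (r : ℝ) (x : E) : ramp Z r x ≤ 1 := min_le_left _ _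

theorem abs_ramp_le_one (Z : Set E) (r : ℝ) (x : E) : |ramp Z r x| ≤ 1 := by
  rw [abs_of_nonneg (ramp_nonneg Z r x)]; exact ramp_le_one Z r x

theorem ramp_eq_zero {Z : Set E} {r : ℝ} (hr : 0 < r) {x : E} (h : infDist x Z ≤ r) :
    ramp Z r x = 0 := by
  have : infDist x Z / r ≤ 1 := (div_le_one hr).2 h
  rw [ramp, max_eq_left (by linarith), min_eq_right zero_le_one]

theorem ramp_eq_one {Z : Set E} {r : ℝ} (hr : 0 < r) {x : E} (h : 2 * r ≤ infDist x Z) :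
    ramp Z r x = 1 := by
  have : 2 ≤ infDist x Z / r := (le_div_iff₀ hr).2 h
  rw [ramp, min_eq_left]
  exact le_max_of_le_right (by linarith)

theorem lipschitzWith_ramp (Z : Set E) {r : ℝ} (hr : 0 < r) :
    LipschitzWith (Real.toNNReal (1 / r)) (ramp Z r) := by
  have h : LipschitzWith (Real.toNNReal (1 / r)) fun x => infDist x Z / r - 1 := by
    refine LipschitzWith.of_dist_le_mul fun x y => ?_
    have := (lipschitz_infDist_pt Z).dist_le_mul x y
    simp only [NNReal.coe_one, one_mul, Real.dist_eq] at this
    rw [Real.coe_toNNReal _ (by positivity), Real.dist_eq,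
      show infDist x Z / r - 1 - (infDist y Z / r - 1) = (1 / r) * (infDist x Z - infDist y Z) by
        ring, abs_mul, abs_of_pos (by positivity : 0 < 1 / r)]
    gcongr
  exact (h.const_max 0).const_min 1

theorem norm_fderiv_ramp_le (Z : Set E) {r : ℝ} (hr : 0 < r) (x : E) :
    ‖fderiv ℝ (ramp Z r) x‖ ≤ 1 / r := by
  have := norm_fderiv_le_of_lipschitz ℝ (lipschitzWith_ramp Z hr) (x₀ := x)
  rwa [Real.coe_toNNReal _ (by positivity)] at this

theorem fderiv_ramp_of_lt {Z : Set E} {r : ℝ} (hr : 0 < r) {x : E} (h : infDist x Z < r) :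
    fderiv ℝ (ramp Z r) x = 0 := by
  have : ramp Z r =ᶠ[𝓝 x] fun _ => 0 := by
    filter_upwards [(continuous_infDist_pt Z).continuousAt.eventually_lt continuousAt_const h]
      with y hy using ramp_eq_zero hr hy.le
  rw [this.fderiv_eq]; simp

theorem fderiv_ramp_of_gt {Z : Set E} {r : ℝ} (hr : 0 < r) {x : E} (h : 2 * r < infDist x Z) :
    fderiv ℝ (ramp Z r) x = 0 := by
  have : ramp Z r =ᶠ[𝓝 x] fun _ => 1 := by
    filter_upwards [(continuous_const (y := 2 * r)).continuousAt.eventually_lt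
      (continuous_infDist_pt Z).continuousAt h] with y hy using ramp_eq_one hr hy.le
  rw [this.fderiv_eq]; simp

theorem tsupport_ramp_subset {Z : Set E} {r : ℝ} (hr : 0 < r) :
    tsupport (ramp Z r) ⊆ {x | r ≤ infDist x Z} := by
  refine closure_minimal (fun x hx => ?_)
    (isClosed_le continuous_const (continuous_infDist_pt Z))
  by_contra h
  exact hx (ramp_eq_zero hr (not_le.1 h).le)

/-- At every point the ramps of widths `1 / (n + 1)` are eventually flat. -/
theorem eventually_fderiv_ramp_eq_zero (Z : Set E) (x : E) :
    ∀ᶠ n : ℕ in atTop, fderiv ℝ (ramp Z (1 / ((n : ℝ) + 1))) x = 0 := by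
  have hpos : ∀ n : ℕ, 0 < 1 / ((n : ℝ) + 1) := fun n => by positivity
  rcases (infDist_nonneg (x := x) (s := Z)).eq_or_lt with h | h
  · exact Eventually.of_forall fun n => fderiv_ramp_of_lt (hpos n) (h ▸ hpos n)
  · filter_upwards [(tendsto_one_div_add_atTop_nhds_zero_nat (𝕜 := ℝ)).eventually_lt_const
      (half_pos h)] with n hn
    exact fderiv_ramp_of_gt (hpos n) (by linarith)

theorem eventually_ramp_eq_one {Z : Set E} {x : E} (h : 0 < infDist x Z) :
    ∀ᶠ n : ℕ in atTop, ramp Z (1 / ((n : ℝ) + 1)) x = 1 := by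
  filter_upwards [(tendsto_one_div_add_atTop_nhds_zero_nat (𝕜 := ℝ)).eventually_lt_const
    (half_pos h)] with n hn
  exact ramp_eq_one (by positivity) (by linarith)

theorem exists_lipschitzWith_mul {ζ χ : E → ℝ} {C K : NNReal} (hζ : LipschitzWith C ζ)
    (hc : HasCompactSupport ζ) (hχ : LipschitzWith K χ) :
    ∃ D, LipschitzWith D fun x => ζ x * χ x := by
  obtain ⟨A, hA⟩ := hc.exists_bound_of_continuous hζ.continuous
  obtain ⟨M, hM⟩ := hc.isCompact.exists_bound_of_continuousOn hχ.continuous.continuousOn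
  have hA0 : 0 ≤ A := (norm_nonneg _).trans (hA 0)
  have hM' : ∀ x ∈ tsupport ζ, ‖χ x‖ ≤ max M 0 := fun x hx => (hM x hx).trans (le_max_left _ _)
  have hD : 0 ≤ A * K + max M 0 * C := by positivity
  have key : ∀ x, ∀ y ∈ tsupport ζ,
      dist (ζ x * χ x) (ζ y * χ y) ≤ (A * K + max M 0 * C) * dist x y := by
    intro x y hy
    have h1 := hζ.dist_le_mul x y
    have h2 := hχ.dist_le_mul x y
    rw [Real.dist_eq] at h1 h2 ⊢
    calc |ζ x * χ x - ζ y * χ y| = |ζ x * (χ x - χ y) + χ y * (ζ x - ζ y)| := by ring_nf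
      _ ≤ |ζ x| * |χ x - χ y| + |χ y| * |ζ x - ζ y| := by
        rw [← abs_mul, ← abs_mul]; exact abs_add_le _ _
      _ ≤ A * (K * dist x y) + max M 0 * (C * dist x y) := by
        have := hA x
        have := hM' y hy
        simp only [Real.norm_eq_abs] at *
        gcongr
      _ = _ := by ring
  refine ⟨⟨_, hD⟩, LipschitzWith.of_dist_le_mul fun x y => ?_⟩
  change _ ≤ (A * K + max M 0 * C) * dist x y
  by_cases hy : y ∈ tsupport ζ
  · exact key x y hy
  by_cases hx : x ∈ tsupport ζ
  · rw [dist_comm, dist_comm x]; exact key y x hx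
  · rw [image_eq_zero_of_notMem_tsupport hx, image_eq_zero_of_notMem_tsupport hy]
    simp only [zero_mul, dist_self]; positivity

theorem LipTest.mul_lipschitz {V W : Set E} {ζ χ : E → ℝ} {K : NNReal} (hζ : LipTest V ζ)
    (hχ : LipschitzWith K χ) (hW : tsupport ζ ∩ tsupport χ ⊆ W) :
    LipTest W fun x => ζ x * χ x := by
  obtain ⟨⟨C, hC⟩, hc, hs⟩ := hζ
  exact ⟨exists_lipschitzWith_mul hC hc hχ, hc.mul_right,
    fun x hx => hW ⟨tsupport_mul_subset_left hx, tsupport_mul_subset_right hx⟩⟩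

theorem LipTest.mono {V W : Set E} {ζ : E → ℝ} (hζ : LipTest V ζ) (h : V ⊆ W) : LipTest W ζ :=
  ⟨hζ.lip, hζ.comp, hζ.sub.trans h⟩

end Ramp

section Green

set_option linter.unusedSectionVars false

open Filter Topology Metric

variable {E : Type*} [NormedAddCommGroup E] [NormedSpace ℝ E] [MeasurableSpace E]

/-- The integrand `div (ζ φ w)`, where `g` plays the role of `div w`. -/
def greenFun (w : E → E) (g φ ζ : E → ℝ) (x : E) : ℝ :=
  ζ x * fderiv ℝ φ x (w x) + φ x * fderiv ℝ ζ x (w x) + g x * φ x * ζ x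

/-- The integral of `div (ζ φ w)` over `Ω`. -/
def green (μ : Measure E) (Ω : Set E) (w : E → E) (g φ ζ : E → ℝ) : ℝ :=
  ∫ x in Ω, greenFun w g φ ζ x ∂μ

variable [FiniteDimensional ℝ E] [BorelSpace E] {μ : Measure E} [μ.IsAddHaarMeasure]

/-- A differentiable function has vanishing derivative at almost every zero. -/
theorem ae_fderiv_eq_zero_of_eq_zero {F : E → ℝ} {S : Set E} (hS : MeasurableSet S)
    (hd : ∀ x ∈ S, DifferentiableAt ℝ F x) (h0 : ∀ x ∈ S, F x = 0) :
    ∀ᵐ x ∂μ.restrict S, fderiv ℝ F x = 0 := by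
  rcases subsingleton_or_nontrivial E with hE | hE
  · exact Eventually.of_forall fun x => by
      ext v; rw [Subsingleton.elim v 0]; simp
  obtain ⟨v, hv⟩ := exists_ne (0 : E)
  have h1 : ApproximatesLinearOn (fun x => F x • v) (0 : E →L[ℝ] E) S 0 := by
    intro x hx y hy
    simp [h0 x hx, h0 y hy]
  have h2 := h1.norm_fderiv_sub_le μ hS (fun x => (fderiv ℝ F x).smulRight v)
    fun x hx => ((hd x hx).hasFDerivAt.smul_const v).hasFDerivWithinAt
  filter_upwards [h2] with x hx
  simpa [hv] using hx

variable {Ω : Set E} {w : E → E} {g φ : E → ℝ}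

theorem integrableOn_mul_fderiv (hΩ : MeasurableSet Ω) (hw : IntegrableOn w Ω μ)
    {ζ : E → ℝ} (hφ : AEStronglyMeasurable φ (μ.restrict Ω)) {M : ℝ} {C : NNReal}
    (hM : ∀ x ∈ Ω, x ∈ tsupport ζ → |φ x| ≤ M) (hC : LipschitzWith C ζ) :
    IntegrableOn (fun x => φ x * fderiv ℝ ζ x (w x)) Ω μ := by
  refine Integrable.mono' ((hw.norm.const_mul C).const_mul |M|)
    (hφ.mul (aestronglyMeasurable_clm_apply
      (measurable_fderiv ℝ ζ).aestronglyMeasurable hw.aestronglyMeasurable)) ?_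
  filter_upwards [ae_restrict_mem hΩ] with x hx
  by_cases hxs : x ∈ tsupport ζ
  · rw [norm_mul]
    have h1 : ‖fderiv ℝ ζ x (w x)‖ ≤ C * ‖w x‖ :=
      (ContinuousLinearMap.le_opNorm _ _).trans (by
        gcongr; exact norm_fderiv_le_of_lipschitz ℝ hC)
    have h2 : ‖φ x‖ ≤ |M| := (hM x hx hxs).trans (le_abs_self _)
    gcongr
  · rw [fderiv_of_notMem_tsupport ℝ hxs]
    simp only [zero_apply, mul_zero, norm_zero]
    positivity

theorem integrableOn_mul_mul (hΩ : MeasurableSet Ω) (hg : IntegrableOn g Ω μ)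
    {ζ : E → ℝ} (hφ : AEStronglyMeasurable φ (μ.restrict Ω)) {M B : ℝ}
    (hM : ∀ x ∈ Ω, x ∈ tsupport ζ → |φ x| ≤ M) (hc : Continuous ζ) (hB : ∀ x, |ζ x| ≤ B) :
    IntegrableOn (fun x => g x * φ x * ζ x) Ω μ := by
  refine Integrable.mono' ((hg.norm.mul_const |M|).mul_const B)
    ((hg.aestronglyMeasurable.mul hφ).mul hc.aestronglyMeasurable) ?_
  filter_upwards [ae_restrict_mem hΩ] with x hx
  have hB0 : 0 ≤ B := (abs_nonneg _).trans (hB x)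
  by_cases hxs : x ∈ tsupport ζ
  · rw [norm_mul, norm_mul]
    have h2 : ‖φ x‖ ≤ |M| := (hM x hx hxs).trans (le_abs_self _)
    have h3 := hB x
    rw [← Real.norm_eq_abs] at h3
    gcongr
  · rw [image_eq_zero_of_notMem_tsupport hxs]
    simp only [mul_zero, norm_zero]
    positivity

theorem integrableOn_bdd_mul {q ζ : E → ℝ} (hq : IntegrableOn q Ω μ) {B : ℝ}
    (hc : Continuous ζ) (hB : ∀ x, |ζ x| ≤ B) : IntegrableOn (fun x => ζ x * q x) Ω μ :=
  Integrable.bdd_mul (c := B) hq hc.aestronglyMeasurable (Eventually.of_forall hB)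

theorem integrableOn_greenFun (hΩ : MeasurableSet Ω) (hw : IntegrableOn w Ω μ)
    (hg : IntegrableOn g Ω μ) {ζ : E → ℝ} (hφ : AEStronglyMeasurable φ (μ.restrict Ω))
    (hq : IntegrableOn (fun x => fderiv ℝ φ x (w x)) Ω μ) {M B : ℝ} {C : NNReal}
    (hM : ∀ x ∈ Ω, x ∈ tsupport ζ → |φ x| ≤ M) (hC : LipschitzWith C ζ)
    (hB : ∀ x, |ζ x| ≤ B) :
    IntegrableOn (greenFun w g φ ζ) Ω μ :=
  ((integrableOn_bdd_mul hq hC.continuous hB).add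
    (integrableOn_mul_fderiv hΩ hw hφ hM hC)).add
    (integrableOn_mul_mul hΩ hg hφ hM hC.continuous hB)

theorem LipTest.integrableOn_greenFun (hΩ : IsOpen Ω) (hw : IntegrableOn w Ω μ)
    (hg : IntegrableOn g Ω μ) (hφ : ContinuousOn φ Ω)
    (hq : IntegrableOn (fun x => fderiv ℝ φ x (w x)) Ω μ) {ζ : E → ℝ} (hζ : LipTest Ω ζ) :
    IntegrableOn (greenFun w g φ ζ) Ω μ := by
  obtain ⟨⟨C, hC⟩, hc, hs⟩ := hζ
  obtain ⟨B, hB⟩ := hc.exists_bound_of_continuous hC.continuous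
  obtain ⟨M, hM⟩ := hc.isCompact.exists_bound_of_continuousOn (hφ.mono hs)
  exact _root_.integrableOn_greenFun hΩ.measurableSet hw hg
    (hφ.aestronglyMeasurable hΩ.measurableSet) hq (fun x _ hx => hM x hx) hC hB

/-- The formula `green = 0` passes from the complement of a null set of jumps: it suffices to test
away from a set `A` to which `φ` is attached in a Lipschitz way. -/
theorem green_eq_zero_of_lipschitz_near (hΩ : IsOpen Ω) (hw : IntegrableOn w Ω μ)
    (hg : IntegrableOn g Ω μ) (hdiv : WeakDiv μ Ω w g) (hφ : DifferentiableOn ℝ φ Ω)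
    (hq : IntegrableOn (fun x => fderiv ℝ φ x (w x)) Ω μ)
    {A V : Set E} {N : ℝ} {K : NNReal} {L : E → ℝ} (hL : LipschitzWith K L)
    (hV : IsOpen V) (hVΩ : V ⊆ Ω) (hN : ∀ y ∈ V, |φ y - L y| ≤ N * infDist y A)
    (hA : ∀ ζ, LipTest (V ∩ {x | 0 < infDist x A}) ζ → green μ Ω w g φ ζ = 0)
    {ζ : E → ℝ} (hζ : LipTest V ζ) : green μ Ω w g φ ζ = 0 := by
  obtain ⟨⟨C, hC⟩, hc, hs⟩ := id hζ
  obtain ⟨B, hB⟩ := hc.exists_bound_of_continuous hC.continuous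
  have hB0 : 0 ≤ B := (norm_nonneg _).trans (hB 0)
  have hcV : ContinuousOn (fun x => φ x - L x) V :=
    (hφ.continuousOn.mono hVΩ).sub hL.continuous.continuousOn
  obtain ⟨M, hM⟩ := hc.isCompact.exists_bound_of_continuousOn (hcV.mono hs)
  have hΩm := hΩ.measurableSet
  let r : ℕ → ℝ := fun n => 1 / ((n : ℝ) + 1)
  have hr : ∀ n, 0 < r n := fun n => by positivity
  have hψm : AEStronglyMeasurable (fun x => φ x - L x) (μ.restrict Ω) :=
    (hφ.continuousOn.aestronglyMeasurable hΩm).sub hL.continuous.aestronglyMeasurable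
  have hLw : IntegrableOn (fun x => fderiv ℝ L x (w x)) Ω μ := by
    simpa using integrableOn_mul_fderiv (φ := fun _ => 1) (M := 1) hΩm hw
      aestronglyMeasurable_const (by simp) hL
  have hLae := hL.ae_differentiableAt (μ := μ)
  have hζae := hC.ae_differentiableAt (μ := μ)
  -- the vector field tested against `ζ (φ - L)`
  let H : E → ℝ := fun x => ζ x * (fderiv ℝ φ x (w x) - fderiv ℝ L x (w x)) +
    (φ x - L x) * fderiv ℝ ζ x (w x) + g x * (φ x - L x) * ζ x
  let G : ℕ → E → ℝ := fun n x => ramp A (r n) x * H x +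
    (φ x - L x) * ζ x * fderiv ℝ (ramp A (r n)) x (w x)
  have hH : IntegrableOn H Ω μ :=
    ((integrableOn_bdd_mul (hq.sub hLw) hC.continuous hB).add
      (integrableOn_mul_fderiv hΩm hw hψm (fun x _ hx => hM x hx) hC)).add
      (integrableOn_mul_mul hΩm hg hψm (fun x _ hx => hM x hx) hC.continuous hB)
  have hLζ : LipTest Ω fun x => ζ x * L x :=
    hζ.mul_lipschitz hL fun x hx => hVΩ (hs hx.1)
  have hprod : ∀ᵐ x ∂μ, fderiv ℝ (fun x => ζ x * L x) x (w x) =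
      ζ x * fderiv ℝ L x (w x) + L x * fderiv ℝ ζ x (w x) := by
    filter_upwards [hLae, hζae] with x h1 h2
    rw [fderiv_fun_mul h2 h1]; simp
  have hG0 : ∀ n, ∫ x in Ω, G n x ∂μ = 0 := by
    intro n
    have hχ := lipschitzWith_ramp A (hr n)
    have t1 : LipTest (V ∩ {x | 0 < infDist x A}) fun x => ζ x * ramp A (r n) x :=
      hζ.mul_lipschitz hχ fun x hx =>
        ⟨hs hx.1, (hr n).trans_le (tsupport_ramp_subset (hr n) hx.2)⟩
    have t2 : LipTest Ω fun x => (ζ x * L x) * ramp A (r n) x :=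
      hLζ.mul_lipschitz hχ fun x hx => hLζ.sub hx.1
    have e1 := hA _ t1
    have e2 := hdiv.lipschitz hw hg hΩ t2
    have i1 := (t1.mono (inter_subset_left.trans hVΩ)).integrableOn_greenFun hΩ hw hg
      hφ.continuousOn hq
    have i2 := t2.integrableOn_greenFun hΩ hw hg (φ := fun _ => 1) continuousOn_const
      (by simp [IntegrableOn])
    have e2' : green μ Ω w g (fun _ => 1) (fun x => (ζ x * L x) * ramp A (r n) x) = 0 := by
      rw [green, ← e2]
      refine integral_congr_ae (Eventually.of_forall fun x => ?_)
      simp [greenFun]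
    rw [show (0 : ℝ) = 0 - 0 by ring]
    nth_rw 1 [← e1]
    rw [← e2', green, green, ← integral_sub i1 i2]
    refine integral_congr_ae (ae_restrict_of_ae ?_)
    filter_upwards [hLae, hζae, hχ.ae_differentiableAt (μ := μ), hprod] with x h1 h2 h3 h4
    simp only [greenFun, G, H]
    rw [fderiv_fun_mul h2 h3, fderiv_fun_mul (c := fun x => ζ x * L x) (h2.mul h1) h3]
    simp [h4]
    ring
  have hT : Tendsto (fun n => ∫ x in Ω, G n x ∂μ) atTop (𝓝 (∫ x in Ω, H x ∂μ)) := by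
    refine tendsto_integral_of_dominated_convergence
      (fun x => ‖H x‖ + 2 * |N| * B * ‖w x‖) ?_ (hH.norm.add (hw.norm.const_mul _)) ?_ ?_
    · intro n
      exact ((lipschitzWith_ramp A (hr n)).continuous.aestronglyMeasurable.mul
        hH.aestronglyMeasurable).add ((hψm.mul hC.continuous.aestronglyMeasurable).mul
        (aestronglyMeasurable_clm_apply (measurable_fderiv ℝ _).aestronglyMeasurable
          hw.aestronglyMeasurable))
    · intro n
      refine Eventually.of_forall fun x => (norm_add_le _ _).trans (add_le_add ?_ ?_)
      · rw [norm_mul]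
        exact mul_le_of_le_one_left (norm_nonneg _) (abs_ramp_le_one _ _ _)
      · by_cases hx : x ∈ tsupport ζ
        · rcases le_or_gt (infDist x A) (2 * r n) with hd | hd
          · have h1 : |φ x - L x| ≤ |N| * (2 * r n) := (hN x (hs hx)).trans (by
              have := le_abs_self N
              have := infDist_nonneg (x := x) (s := A)
              gcongr)
            have h2 : ‖fderiv ℝ (ramp A (r n)) x (w x)‖ ≤ 1 / r n * ‖w x‖ :=
              (ContinuousLinearMap.le_opNorm _ _).trans (by
                gcongr; exact norm_fderiv_ramp_le A (hr n) x)
            have h3 := hB x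
            rw [norm_mul, norm_mul]
            calc _ ≤ |N| * (2 * r n) * B * (1 / r n * ‖w x‖) := by
                  rw [← Real.norm_eq_abs] at h1
                  gcongr
              _ = _ := by have := (hr n).ne'; field_simp
          · rw [fderiv_ramp_of_gt (hr n) hd]
            simp only [zero_apply, mul_zero, norm_zero]
            positivity
        · rw [image_eq_zero_of_notMem_tsupport hx]
          simp only [mul_zero, zero_mul, norm_zero]
          positivity
    · -- on the set `infDist x A = 0` the gradients of `φ` and `L` agree almost everywhere
      let S : Set E := (V ∩ {x | infDist x A = 0}) ∩ {x | DifferentiableAt ℝ L x}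
      have hS : MeasurableSet S := (hV.measurableSet.inter
        (isClosed_eq (continuous_infDist_pt A) continuous_const).measurableSet).inter
        (measurableSet_of_differentiableAt ℝ L)
      have hφd : ∀ x ∈ V, DifferentiableAt ℝ φ x := fun x hx =>
        (hφ x (hVΩ hx)).differentiableAt (hΩ.mem_nhds (hVΩ hx))
      have hz : ∀ x ∈ V, infDist x A = 0 → φ x - L x = 0 := fun x hx h0 => by
        have := hN x hx
        rw [h0, mul_zero] at this
        exact abs_eq_zero.1 (le_antisymm this (abs_nonneg _))
      have hSae := ae_fderiv_eq_zero_of_eq_zero (μ := μ) (F := fun x => φ x - L x) hS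
        (fun x hx => (hφd x hx.1.1).sub hx.2) (fun x hx => hz x hx.1.1 hx.1.2)
      rw [ae_restrict_iff' hS] at hSae
      refine ae_restrict_of_ae ?_
      filter_upwards [hSae, hLae] with x h1 h2
      have hfin : Tendsto (fun n => G n x) atTop (𝓝 (H x)) := by
        by_cases hx : x ∈ tsupport ζ
        · rcases (infDist_nonneg (x := x) (s := A)).eq_or_lt with hd | hd
          · have h3 := h1 ⟨⟨hs hx, hd.symm⟩, h2⟩
            rw [fderiv_fun_sub (hφd x (hs hx)) h2] at h3
            have h4 : fderiv ℝ φ x (w x) - fderiv ℝ L x (w x) = 0 := by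
              rw [← sub_apply, h3]; rfl
            have h5 : H x = 0 := by simp [H, h4, hz x (hs hx) hd.symm]
            have h6 : ∀ n, G n x = 0 := fun n => by simp [G, h5, hz x (hs hx) hd.symm]
            simp_rw [h5, h6]
            exact tendsto_const_nhds
          · refine tendsto_const_nhds.congr' ?_
            filter_upwards [eventually_fderiv_ramp_eq_zero A x, eventually_ramp_eq_one hd]
              with n h3 h4
            simp only [G, r, h3, h4]
            simp
        · have h0 := image_eq_zero_of_notMem_tsupport hx
          have h5 : H x = 0 := by simp [H, h0, fderiv_of_notMem_tsupport ℝ hx]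
          have h6 : ∀ n, G n x = 0 := fun n => by simp [G, h5, h0]
          simp_rw [h5, h6]
          exact tendsto_const_nhds
      exact hfin
  simp_rw [hG0] at hT
  have hH0 := tendsto_nhds_unique hT tendsto_const_nhds
  have i2 := hLζ.integrableOn_greenFun hΩ hw hg (φ := fun _ => 1) continuousOn_const
    (by simp [IntegrableOn])
  have e2 : green μ Ω w g (fun _ => 1) (fun x => ζ x * L x) = 0 := by
    rw [green, ← hdiv.lipschitz hw hg hΩ hLζ]
    refine integral_congr_ae (Eventually.of_forall fun x => ?_)
    simp [greenFun]
  have e3 : (0 : ℝ) = (∫ x in Ω, H x ∂μ) + green μ Ω w g (fun _ => 1) (fun x => ζ x * L x) := by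
    rw [hH0, e2, add_zero]
  rw [e3, green, green, ← integral_add hH i2]
  refine integral_congr_ae (ae_restrict_of_ae ?_)
  filter_upwards [hprod] with x h4
  simp only [greenFun, H, h4]
  simp
  ring

end Green

section InteriorGreen

set_option linter.unusedSectionVars false

open Filter Topology Metric

variable {E : Type*} [NormedAddCommGroup E] [NormedSpace ℝ E] [MeasurableSpace E]
  [FiniteDimensional ℝ E] [BorelSpace E] {μ : Measure E} [μ.IsAddHaarMeasure]
  {Ω : Set E} {w : E → E} {g φ : E → ℝ}

theorem green_add (hΩ : IsOpen Ω) (hw : IntegrableOn w Ω μ)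
    (hg : IntegrableOn g Ω μ) (hφ : ContinuousOn φ Ω)
    (hq : IntegrableOn (fun x => fderiv ℝ φ x (w x)) Ω μ) {ζ ξ : E → ℝ} (hζ : LipTest Ω ζ)
    (hξ : LipTest Ω ξ) :
    green μ Ω w g φ (fun x => ζ x + ξ x) = green μ Ω w g φ ζ + green μ Ω w g φ ξ := by
  rw [green, green, green, ← integral_add (hζ.integrableOn_greenFun hΩ hw hg hφ hq)
    (hξ.integrableOn_greenFun hΩ hw hg hφ hq)]
  obtain ⟨C, hC⟩ := hζ.lip
  obtain ⟨D, hD⟩ := hξ.lip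
  refine integral_congr_ae (ae_restrict_of_ae ?_)
  filter_upwards [hC.ae_differentiableAt (μ := μ), hD.ae_differentiableAt (μ := μ)] with x h1 h2
  simp only [greenFun]
  rw [fderiv_fun_add h1 h2]
  simp
  ring

theorem green_eq_zero_union (hΩ : IsOpen Ω) (hw : IntegrableOn w Ω μ)
    (hg : IntegrableOn g Ω μ) (hφ : ContinuousOn φ Ω)
    (hq : IntegrableOn (fun x => fderiv ℝ φ x (w x)) Ω μ) {U V : Set E}
    (hU : IsOpen U) (hV : IsOpen V) (hUΩ : U ⊆ Ω) (hVΩ : V ⊆ Ω)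
    (gU : ∀ ζ, LipTest U ζ → green μ Ω w g φ ζ = 0)
    (gV : ∀ ζ, LipTest V ζ → green μ Ω w g φ ζ = 0)
    {ζ : E → ℝ} (hζ : LipTest (U ∪ V) ζ) : green μ Ω w g φ ζ = 0 := by
  rcases (tsupport ζ \ V).eq_empty_or_nonempty with h | hne
  · exact gV ζ ⟨hζ.lip, hζ.comp, sdiff_eq_empty.1 h⟩
  have hK : IsCompact (tsupport ζ \ V) := hζ.comp.isCompact.diff hV
  have hKU : tsupport ζ \ V ⊆ U := fun x hx => (hζ.sub hx.1).resolve_right hx.2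
  obtain ⟨δ, hδ, hδU⟩ := hK.exists_cthickening_subset_open hU hKU
  have hr : 0 < δ / 2 := half_pos hδ
  have hχ := lipschitzWith_ramp (tsupport ζ \ V) hr
  have hχ' : LipschitzWith _ fun x => 1 - ramp (tsupport ζ \ V) (δ / 2) x :=
    (LipschitzWith.const (1 : ℝ)).sub hχ
  have t1 := hζ.mul_lipschitz (W := V) hχ fun x hx => by
    by_contra hxV
    have h1 := tsupport_ramp_subset hr hx.2
    have h2 : x ∈ tsupport ζ \ V := ⟨hx.1, hxV⟩
    rw [mem_ofPred_eq, infDist_zero_of_mem h2] at h1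
    linarith
  have t2 := hζ.mul_lipschitz (W := U) hχ' fun x hx => by
    apply hδU
    have h1 : tsupport (fun x => 1 - ramp (tsupport ζ \ V) (δ / 2) x) ⊆
        {x | infDist x (tsupport ζ \ V) ≤ δ} := by
      refine closure_minimal (fun x hx => ?_)
        (isClosed_le (continuous_infDist_pt _) continuous_const)
      by_contra h
      rw [mem_ofPred_eq, not_le] at h
      refine hx ?_
      simp [ramp_eq_one hr (show 2 * (δ / 2) ≤ infDist x (tsupport ζ \ V) by linarith)]
    have h2 := h1 hx.2
    rw [mem_cthickening_iff, ENNReal.le_ofReal_iff_toReal_le (infEDist_ne_top hne) hδ.le]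
    exact h2
  have h3 := green_add hΩ hw hg hφ hq (t1.mono hVΩ) (t2.mono hUΩ)
  rw [gV _ t1, gU _ t2] at h3
  rw [← add_zero (0 : ℝ), ← h3]
  congr 1
  ext x
  ring

theorem green_eq_zero_of_locally (hΩ : IsOpen Ω) (hw : IntegrableOn w Ω μ)
    (hg : IntegrableOn g Ω μ) (hφ : ContinuousOn φ Ω)
    (hq : IntegrableOn (fun x => fderiv ℝ φ x (w x)) Ω μ) {ζ : E → ℝ} (hζ : LipTest Ω ζ)
    (hloc : ∀ x ∈ tsupport ζ, ∃ V, IsOpen V ∧ x ∈ V ∧ V ⊆ Ω ∧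
      ∀ ξ, LipTest V ξ → green μ Ω w g φ ξ = 0) : green μ Ω w g φ ζ = 0 := by
  suffices h : ∃ U, IsOpen U ∧ tsupport ζ ⊆ U ∧ U ⊆ Ω ∧
      ∀ ξ, LipTest U ξ → green μ Ω w g φ ξ = 0 by
    obtain ⟨U, -, h1, -, h2⟩ := h
    exact h2 ζ ⟨hζ.lip, hζ.comp, h1⟩
  refine hζ.comp.isCompact.induction_on (p := fun s => ∃ U, IsOpen U ∧ s ⊆ U ∧ U ⊆ Ω ∧
      ∀ ξ, LipTest U ξ → green μ Ω w g φ ξ = 0) ?_ ?_ ?_ ?_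
  · refine ⟨∅, isOpen_empty, Subset.rfl, empty_subset _, fun ξ hξ => ?_⟩
    have : ξ = fun _ => 0 := by
      have := tsupport_eq_empty_iff.1 (subset_empty_iff.1 hξ.sub)
      exact this
    simp [green, greenFun, this]
  · rintro s t hst ⟨U, h1, h2, h3⟩
    exact ⟨U, h1, hst.trans h2, h3⟩
  · rintro s t ⟨U, h1, h2, h3, h4⟩ ⟨V, k1, k2, k3, k4⟩
    exact ⟨U ∪ V, h1.union k1, union_subset_union h2 k2, union_subset h3 k3,
      fun ξ hξ => green_eq_zero_union hΩ hw hg hφ hq h1 k1 h3 k3 h4 k4 hξ⟩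
  · intro x hx
    obtain ⟨V, h1, h2, h3⟩ := hloc x hx
    exact ⟨V, mem_nhdsWithin_of_mem_nhds (h1.mem_nhds h2), V, h1, Subset.rfl, h3⟩

/-- A function differentiable on `Ω` is, on each nonempty relatively closed subset `B`,
Lipschitz on some portion of `B` with a uniform estimate at nearby points. -/
theorem exists_portion_lipschitz (hΩ : IsOpen Ω) (hφ : DifferentiableOn ℝ φ Ω) {O : Set E}
    (hO : IsOpen O) (hne : (Ω \ O).Nonempty) :
    ∃ x₀ ∈ Ω \ O, ∃ ρ > 0, ∃ N : NNReal, ball x₀ ρ ⊆ Ω ∧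
      ∀ x ∈ (Ω \ O) ∩ ball x₀ ρ, ∀ y ∈ ball x₀ ρ, |φ y - φ x| ≤ N * dist y x := by
  have hlc : IsLocallyClosed (Ω \ O) :=
    hΩ.isLocallyClosed.inter hO.isClosed_compl.isLocallyClosed
  have := hlc.locallyCompactSpace
  have : Nonempty ↥(Ω \ O) := hne.to_subtype
  let S : ℕ → Set ↥(Ω \ O) := fun N => {x | ∀ y ∈ Ω, dist y x < 1 / ((N : ℝ) + 1) →
    |φ y - φ x| ≤ N * dist y (x : E)}
  have hcont : Continuous fun x : ↥(Ω \ O) => φ x :=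
    continuousOn_iff_continuous_domRestrict.1 (hφ.continuousOn.mono sdiff_subset)
  have hScl : ∀ N, IsClosed (S N) := by
    intro N
    have : S N = ⋂ y ∈ Ω, ({x : ↥(Ω \ O) | 1 / ((N : ℝ) + 1) ≤ dist y (x : E)} ∪
        {x : ↥(Ω \ O) | |φ y - φ x| ≤ N * dist y (x : E)}) := by
      ext x
      simp only [S, mem_ofPred_eq, mem_iInter, mem_union]
      refine forall₂_congr fun y _ => ?_
      rw [or_iff_not_imp_left, not_le]
    rw [this]
    refine isClosed_biInter fun y _ => IsClosed.union ?_ ?_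
    · exact isClosed_le continuous_const (continuous_const.dist continuous_subtype_val)
    · exact isClosed_le (continuous_const.sub hcont).abs
        (continuous_const.mul (continuous_const.dist continuous_subtype_val))
  have hcov : ⋃ N, S N = univ := by
    refine eq_univ_of_forall fun x => mem_iUnion.2 ?_
    have hd := (hφ x x.2.1).differentiableAt (hΩ.mem_nhds x.2.1)
    obtain ⟨c, hc⟩ := hd.hasFDerivAt.isBigO_sub.bound
    obtain ⟨ε, hε, hball⟩ := Metric.eventually_nhds_iff.1 hc
    obtain ⟨N, hN⟩ := exists_nat_gt (max c (1 / ε))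
    have hNp : (0 : ℝ) < N := lt_of_le_of_lt (by positivity) ((le_max_right _ _).trans_lt hN)
    refine ⟨N, fun y _ hy => ?_⟩
    have h1 : 1 / ((N : ℝ) + 1) ≤ ε := by
      rw [div_le_iff₀ (by positivity)]
      have := (le_max_right c (1 / ε)).trans hN.le
      rw [div_le_iff₀ hε] at this
      nlinarith
    have h2 := hball (hy.trans_le h1)
    rw [dist_eq_norm]
    refine h2.trans ?_
    gcongr
    exact (le_max_left _ _).trans hN.le
  obtain ⟨N, x₀, hx₀⟩ := nonempty_interior_of_iUnion_of_closed hScl hcov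
  obtain ⟨ε, hε, hball⟩ := Metric.isOpen_iff.1 isOpen_interior x₀ hx₀
  obtain ⟨ε', hε', hball'⟩ := Metric.isOpen_iff.1 hΩ x₀ x₀.2.1
  refine ⟨x₀, x₀.2, min (min ε ε') (1 / (2 * ((N : ℝ) + 1))), by positivity, N, ?_, ?_⟩
  · exact (ball_subset_ball ((min_le_left _ _).trans (min_le_right _ _))).trans hball'
  · rintro x ⟨hx, hxb⟩ y hy
    have h1 : (⟨x, hx⟩ : ↥(Ω \ O)) ∈ S N := interior_subset (hball (by
      rw [mem_ball, Subtype.dist_eq]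
      exact hxb.trans_le ((min_le_left _ _).trans (min_le_left _ _))))
    have h2 : dist x x₀ < 1 / (2 * ((N : ℝ) + 1)) := hxb.trans_le (min_le_right _ _)
    have h3 : dist y x₀ < 1 / (2 * ((N : ℝ) + 1)) := hy.trans_le (min_le_right _ _)
    refine h1 y (hball' (ball_subset_ball ((min_le_left _ _).trans (min_le_right _ _)) hy)) ?_
    have h4 := dist_triangle_right y x (x₀ : E)
    have : 1 / ((N : ℝ) + 1) = 1 / (2 * ((N : ℝ) + 1)) + 1 / (2 * ((N : ℝ) + 1)) := by
      field_simp; norm_num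
    change dist y x < _
    linarith

/-- Green's formula for a function which is merely differentiable. -/
theorem green_eq_zero_of_differentiableOn (hΩ : IsOpen Ω) (hw : IntegrableOn w Ω μ)
    (hg : IntegrableOn g Ω μ) (hdiv : WeakDiv μ Ω w g) (hφ : DifferentiableOn ℝ φ Ω)
    (hq : IntegrableOn (fun x => fderiv ℝ φ x (w x)) Ω μ) {ζ : E → ℝ} (hζ : LipTest Ω ζ) :
    green μ Ω w g φ ζ = 0 := by
  let O : Set E := ⋃₀ {V | IsOpen V ∧ V ⊆ Ω ∧ ∀ ξ, LipTest V ξ → green μ Ω w g φ ξ = 0}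
  have hO : IsOpen O := isOpen_sUnion fun V hV => hV.1
  have hgood : ∀ ξ, LipTest Ω ξ → tsupport ξ ⊆ O → green μ Ω w g φ ξ = 0 := by
    intro ξ hξ hsub
    refine green_eq_zero_of_locally hΩ hw hg hφ.continuousOn hq hξ fun x hx => ?_
    obtain ⟨V, ⟨h1, h2, h3⟩, h4⟩ := hsub hx
    exact ⟨V, h1, h4, h2, h3⟩
  rcases (Ω \ O).eq_empty_or_nonempty with he | hne
  · exact hgood ζ hζ (hζ.sub.trans (sdiff_eq_empty.1 he))
  exfalso
  obtain ⟨x₀, hx₀, ρ, hρ, N, hb, hN⟩ := exists_portion_lipschitz hΩ hφ hO hne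
  let A : Set E := (Ω \ O) ∩ ball x₀ ρ
  have hx₀A : x₀ ∈ A := ⟨hx₀, mem_ball_self hρ⟩
  have hLA : LipschitzOnWith N φ A := LipschitzOnWith.of_dist_le_mul fun x hx y hy => by
    rw [Real.dist_eq]; exact hN y hy x hx.2
  obtain ⟨L, hL, hLφ⟩ := hLA.extend_real
  have hVΩ : ball x₀ (ρ / 2) ⊆ Ω := (ball_subset_ball (by linarith)).trans hb
  refine hx₀.2 ⟨ball x₀ (ρ / 2), ⟨isOpen_ball, hVΩ, fun ξ hξ => ?_⟩,
    mem_ball_self (half_pos hρ)⟩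
  refine green_eq_zero_of_lipschitz_near hΩ hw hg hdiv hφ hq hL isOpen_ball hVΩ
    (A := A) (N := 2 * N) ?_ ?_ hξ
  · intro y hy
    have key : ∀ a ∈ A, |φ y - L y| ≤ 2 * N * dist y a := by
      intro a ha
      have h1 := hN a ha y (ball_subset_ball (by linarith) hy)
      have h2 := hL.dist_le_mul a y
      rw [Real.dist_eq, ← hLφ ha, dist_comm] at h2
      have := abs_add_le (φ y - φ a) (φ a - L y)
      rw [show φ y - φ a + (φ a - L y) = φ y - L y by ring] at this
      linarith
    refine le_of_forall_pos_le_add fun ε hε => ?_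
    obtain ⟨a, ha, hlt⟩ := (infDist_lt_iff ⟨x₀, hx₀A⟩).1
      (lt_add_of_pos_right (infDist y A) (show 0 < ε / (2 * N + 1) by positivity))
    refine (key a ha).trans ?_
    have h3 : 2 * N * (ε / (2 * N + 1)) ≤ ε := by
      rw [mul_div_assoc', div_le_iff₀ (by positivity)]
      nlinarith [N.2]
    calc 2 * (N : ℝ) * dist y a ≤ 2 * N * (infDist y A + ε / (2 * N + 1)) := by gcongr
      _ ≤ _ := by rw [mul_add]; linarith
  · intro ξ hξ
    refine hgood ξ (hξ.mono (inter_subset_left.trans hVΩ)) fun x hx => ?_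
    by_contra hxO
    have h1 := hξ.sub hx
    have h2 : x ∈ A := ⟨⟨hVΩ h1.1, hxO⟩, ball_subset_ball (by linarith) h1.1⟩
    have h3 : 0 < infDist x A := h1.2
    rw [infDist_zero_of_mem h2] at h3
    exact lt_irrefl _ h3

end InteriorGreen

section BoundaryGreen

set_option linter.unusedSectionVars false

open Filter Topology Metric

/-- A smooth truncation of the identity, vanishing on `[-r, r]`. -/
def trunc (r t : ℝ) : ℝ := ∫ τ in (0 : ℝ)..t, ramp {(0 : ℝ)} r τ

theorem continuous_ramp_zero {r : ℝ} (hr : 0 < r) : Continuous (ramp {(0 : ℝ)} r) :=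
  (lipschitzWith_ramp _ hr).continuous

theorem hasDerivAt_trunc {r : ℝ} (hr : 0 < r) (t : ℝ) :
    HasDerivAt (trunc r) (ramp {(0 : ℝ)} r t) t :=
  intervalIntegral.integral_hasDerivAt_right ((continuous_ramp_zero hr).intervalIntegrable _ _)
    ((continuous_ramp_zero hr).stronglyMeasurableAtFilter _ _) (continuous_ramp_zero hr).continuousAt

theorem abs_trunc_le (r t : ℝ) : |trunc r t| ≤ |t| := by
  have := intervalIntegral.norm_integral_le_of_norm_le_const (a := 0) (b := t) (C := 1)
    (f := ramp {(0 : ℝ)} r) fun x _ => abs_ramp_le_one _ _ _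
  simpa [trunc] using this

theorem trunc_eq_zero {r t : ℝ} (hr : 0 < r) (ht : |t| ≤ r) : trunc r t = 0 := by
  rw [trunc, intervalIntegral.integral_congr (g := fun _ => (0 : ℝ)) fun τ hτ => ?_]
  · simp
  · refine ramp_eq_zero hr ?_
    rw [infDist_singleton, Real.dist_eq, sub_zero]
    have h1 := abs_sub_left_of_mem_uIcc hτ
    simp only [sub_zero] at h1
    exact h1.trans ht

theorem tendsto_trunc (t : ℝ) :
    Tendsto (fun n : ℕ => trunc (1 / ((n : ℝ) + 1)) t) atTop (𝓝 t) := by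
  have h : t = ∫ τ in (0 : ℝ)..t, (1 : ℝ) := by simp
  nth_rw 2 [h]
  refine intervalIntegral.tendsto_integral_filter_of_dominated_convergence (fun _ => 1)
    (Eventually.of_forall fun n =>
      (continuous_ramp_zero (by positivity)).aestronglyMeasurable)
    (Eventually.of_forall fun n => Eventually.of_forall fun x _ => abs_ramp_le_one _ _ _)
    (by simp) ?_
  have : ∀ᵐ x : ℝ, x ≠ 0 := by simp [ae_iff]
  filter_upwards [this] with x hx _
  refine tendsto_const_nhds.congr' ?_
  filter_upwards [eventually_ramp_eq_one (Z := {(0 : ℝ)}) (x := x)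
    (by rw [infDist_singleton]; exact dist_pos.2 hx)] with n hn
  exact hn.symm

variable {E : Type*} [NormedAddCommGroup E] [NormedSpace ℝ E] [MeasurableSpace E]

/-- An integrable vector field `w` with weak divergence `g` on a bounded open set `Ω`, which does
not concentrate at a closed null set `Z` of exceptional boundary points. -/
structure GreenData (μ : Measure E) (Ω Z : Set E) (w : E → E) (g : E → ℝ) : Prop where
  isOpen : IsOpen Ω
  isBounded : Bornology.IsBounded Ω
  isClosed : IsClosed Z
  nonempty : Z.Nonempty
  null : μ Z = 0
  intw : IntegrableOn w Ω μ
  intg : IntegrableOn g Ω μ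
  div : WeakDiv μ Ω w g
  conc : Tendsto (fun n : ℕ => ((n : ℝ) + 1) *
    ∫ x in Ω ∩ {x | infDist x Z ≤ 2 * (1 / ((n : ℝ) + 1))}, ‖w x‖ ∂μ) atTop (𝓝 0)

/-- Functions to which Green's formula is applied. -/
structure GreenTest (μ : Measure E) (Ω Z : Set E) (w : E → E) (g : E → ℝ) (F : E → ℝ) : Prop where
  diff : DifferentiableOn ℝ F Ω
  cont : ContinuousOn F (closure Ω \ Z)
  intq : IntegrableOn (fun x => fderiv ℝ F x (w x)) Ω μ
  intg : IntegrableOn (fun x => g x * F x) Ω μ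

variable [FiniteDimensional ℝ E] [BorelSpace E] {μ : Measure E} [μ.IsAddHaarMeasure]
  {Ω Z : Set E} {w : E → E} {g : E → ℝ}

theorem GreenData.measurableSet (D : GreenData μ Ω Z w g) : MeasurableSet Ω :=
  D.isOpen.measurableSet

theorem GreenTest.differentiableAt (D : GreenData μ Ω Z w g) {F : E → ℝ}
    (hF : GreenTest μ Ω Z w g F) {x : E} (hx : x ∈ Ω) : DifferentiableAt ℝ F x :=
  (hF.diff x hx).differentiableAt (D.isOpen.mem_nhds hx)

theorem GreenTest.aestronglyMeasurable (D : GreenData μ Ω Z w g) {F : E → ℝ}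
    (hF : GreenTest μ Ω Z w g F) : AEStronglyMeasurable F (μ.restrict Ω) :=
  hF.diff.continuousOn.aestronglyMeasurable D.measurableSet

/-- Composition with a function having bounded derivative. -/
theorem GreenTest.comp (D : GreenData μ Ω Z w g) {F : E → ℝ} (hF : GreenTest μ Ω Z w g F)
    {h h' : ℝ → ℝ} (hh : ∀ t, HasDerivAt h (h' t) t) (hc : Continuous h') {M : ℝ}
    (hM : ∀ t, |h' t| ≤ M) (h0 : ∀ t, |h t| ≤ M * |t|) :
    GreenTest μ Ω Z w g (fun x => h (F x)) ∧
      ∀ x ∈ Ω, fderiv ℝ (fun x => h (F x)) x = h' (F x) • fderiv ℝ F x := by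
  have hfd : ∀ x ∈ Ω, HasFDerivAt (fun x => h (F x)) (h' (F x) • fderiv ℝ F x) x := fun x hx =>
    (hh (F x)).comp_hasFDerivAt x (hF.differentiableAt D hx).hasFDerivAt
  have hcont : Continuous h := continuous_iff_continuousAt.2 fun t => (hh t).continuousAt
  have hFm := hF.aestronglyMeasurable D
  refine ⟨⟨fun x hx => (hfd x hx).differentiableAt.differentiableWithinAt,
    hcont.comp_continuousOn hF.cont, ?_, ?_⟩, fun x hx => (hfd x hx).fderiv⟩
  · have : IntegrableOn (fun x => h' (F x) * fderiv ℝ F x (w x)) Ω μ :=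
      Integrable.bdd_mul (c := M) hF.intq (hc.comp_aestronglyMeasurable hFm)
        (Eventually.of_forall fun x => hM _)
    refine this.congr ?_
    filter_upwards [ae_restrict_mem D.measurableSet] with x hx
    rw [(hfd x hx).fderiv]; simp
  · refine Integrable.mono' (hF.intg.norm.const_mul M)
      (D.intg.aestronglyMeasurable.mul (hcont.comp_aestronglyMeasurable hFm))
      (Eventually.of_forall fun x => ?_)
    rw [norm_mul, norm_mul, mul_left_comm]
    exact mul_le_mul_of_nonneg_left (h0 _) (norm_nonneg _)

theorem GreenTest.sub (D : GreenData μ Ω Z w g) {F G : E → ℝ} (hF : GreenTest μ Ω Z w g F)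
    (hG : GreenTest μ Ω Z w g G) : GreenTest μ Ω Z w g (fun x => F x - G x) := by
  refine ⟨hF.diff.sub hG.diff, hF.cont.sub hG.cont, ?_, ?_⟩
  · refine (hF.intq.sub hG.intq).congr ?_
    filter_upwards [ae_restrict_mem D.measurableSet] with x hx
    rw [fderiv_fun_sub (hF.differentiableAt D hx) (hG.differentiableAt D hx)]; simp
  · refine (hF.intg.sub hG.intg).congr (Eventually.of_forall fun x => ?_)
    simp [mul_sub]

theorem GreenTest.add (D : GreenData μ Ω Z w g) {F G : E → ℝ} (hF : GreenTest μ Ω Z w g F)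
    (hG : GreenTest μ Ω Z w g G) : GreenTest μ Ω Z w g (fun x => F x + G x) := by
  refine ⟨hF.diff.add hG.diff, hF.cont.add hG.cont, ?_, ?_⟩
  · refine (hF.intq.add hG.intq).congr ?_
    filter_upwards [ae_restrict_mem D.measurableSet] with x hx
    rw [fderiv_fun_add (hF.differentiableAt D hx) (hG.differentiableAt D hx)]; simp
  · refine (hF.intg.add hG.intg).congr (Eventually.of_forall fun x => ?_)
    simp [mul_add]

/-- The Green pairing `∫ (∇F · w + g F)`. -/
def gpair (μ : Measure E) (Ω : Set E) (w : E → E) (g F : E → ℝ) : ℝ :=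
  ∫ x in Ω, (fderiv ℝ F x (w x) + g x * F x) ∂μ

theorem GreenTest.integrableOn {F : E → ℝ} (hF : GreenTest μ Ω Z w g F) :
    IntegrableOn (fun x => fderiv ℝ F x (w x) + g x * F x) Ω μ :=
  hF.intq.add hF.intg

theorem GreenTest.gpair_sub (D : GreenData μ Ω Z w g) {F G : E → ℝ} (hF : GreenTest μ Ω Z w g F)
    (hG : GreenTest μ Ω Z w g G) :
    gpair μ Ω w g (fun x => F x - G x) = gpair μ Ω w g F - gpair μ Ω w g G := by
  rw [gpair, gpair, gpair, ← integral_sub hF.integrableOn hG.integrableOn]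
  refine integral_congr_ae ?_
  filter_upwards [ae_restrict_mem D.measurableSet] with x hx
  rw [fderiv_fun_sub (hF.differentiableAt D hx) (hG.differentiableAt D hx)]
  simp only [sub_apply]
  ring

theorem GreenTest.gpair_add (D : GreenData μ Ω Z w g) {F G : E → ℝ} (hF : GreenTest μ Ω Z w g F)
    (hG : GreenTest μ Ω Z w g G) :
    gpair μ Ω w g (fun x => F x + G x) = gpair μ Ω w g F + gpair μ Ω w g G := by
  rw [gpair, gpair, gpair, ← integral_add hF.integrableOn hG.integrableOn]
  refine integral_congr_ae ?_
  filter_upwards [ae_restrict_mem D.measurableSet] with x hx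
  rw [fderiv_fun_add (hF.differentiableAt D hx) (hG.differentiableAt D hx)]
  simp only [add_apply]
  ring

/-- Green's formula against a Lipschitz cutoff that vanishes near the exceptional set, for
functions vanishing on the part of the boundary seen by the cutoff. -/
theorem green_eq_zero_of_frontier (D : GreenData μ Ω Z w g) {F : E → ℝ}
    (hF : GreenTest μ Ω Z w g F) {ζ : E → ℝ} {C : NNReal} (hC : LipschitzWith C ζ) {B : ℝ}
    (hB : ∀ x, |ζ x| ≤ B) (hZ : ∀ x ∈ tsupport ζ, x ∉ Z)
    (h0 : ∀ x ∈ closure Ω, x ∉ Ω → x ∈ tsupport ζ → F x = 0) : green μ Ω w g F ζ = 0 := by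
  have hFm := hF.aestronglyMeasurable D
  let P := closure Ω ∩ tsupport ζ
  have hP : IsCompact P := D.isBounded.isCompact_closure.inter_right (isClosed_tsupport ζ)
  have hFP : ContinuousOn F P := hF.cont.mono fun x hx => ⟨hx.1, hZ x hx.2⟩
  obtain ⟨M, hM⟩ := hP.exists_bound_of_continuousOn hFP
  let r : ℕ → ℝ := fun n => 1 / ((n : ℝ) + 1)
  have hr : ∀ n, 0 < r n := fun n => by positivity
  have hcomp := fun n => hF.comp D (hasDerivAt_trunc (hr n)) (continuous_ramp_zero (hr n))
    (M := 1) (abs_ramp_le_one _ _) fun t => (abs_trunc_le _ _).trans (by simp)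
  have hn : ∀ n, green μ Ω w g (fun x => trunc (r n) (F x)) ζ = 0 := by
    intro n
    let K : Set E := {x ∈ P | r n ≤ |F x|}
    have hK : IsCompact K := by
      have : IsClosed K := by
        have := ContinuousOn.preimage_isClosed_of_isClosed (continuous_abs.comp_continuousOn hFP)
          hP.isClosed (isClosed_Ici (a := r n))
        exact this
      exact hP.of_isClosed_subset this fun x hx => hx.1
    have hKΩ : K ⊆ Ω := fun x hx => by
      by_contra hxΩ
      have h1 := h0 x hx.1.1 hxΩ hx.1.2
      have h2 := hx.2
      rw [h1, abs_zero] at h2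
      exact absurd h2 (not_le.2 (hr n))
    obtain ⟨κ, hκ, hκ1⟩ : ∃ κ : E → ℝ, LipTest Ω κ ∧ ∀ x ∈ K, κ =ᶠ[𝓝 x] fun _ => 1 := by
      rcases K.eq_empty_or_nonempty with he | hne
      · refine ⟨fun _ => 0, ⟨⟨0, LipschitzWith.const 0⟩, ?_, ?_⟩, by simp [he]⟩
        · exact HasCompactSupport.zero
        · have : tsupport (fun _ : E => (0 : ℝ)) = ∅ := tsupport_eq_empty_iff.2 rfl
          simp [this]
      obtain ⟨δ, hδ, hδU⟩ := hK.exists_cthickening_subset_open D.isOpen hKΩ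
      have hδ2 : 0 < δ / 2 := half_pos hδ
      have h1 : tsupport (fun x => 1 - ramp K (δ / 2) x) ⊆ cthickening δ K := by
        have : tsupport (fun x => 1 - ramp K (δ / 2) x) ⊆ {x | infDist x K ≤ δ} := by
          refine closure_minimal (fun x hx => ?_)
            (isClosed_le (continuous_infDist_pt _) continuous_const)
          by_contra h
          rw [mem_ofPred_eq, not_le] at h
          refine hx ?_
          simp [ramp_eq_one hδ2 (show 2 * (δ / 2) ≤ infDist x K by linarith)]
        intro x hx
        have h2 := this hx
        rw [mem_cthickening_iff, ENNReal.le_ofReal_iff_toReal_le (infEDist_ne_top hne) hδ.le]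
        exact h2
      refine ⟨fun x => 1 - ramp K (δ / 2) x,
        ⟨⟨_, (LipschitzWith.const (1 : ℝ)).sub (lipschitzWith_ramp K hδ2)⟩, ?_, h1.trans hδU⟩, ?_⟩
      · exact hK.cthickening.of_isClosed_subset (isClosed_tsupport _) h1
      · intro x hx
        filter_upwards [(continuous_infDist_pt K).continuousAt.eventually_lt continuousAt_const
          (show infDist x K < δ / 2 by rwa [infDist_zero_of_mem hx])] with y hy
        rw [ramp_eq_zero hδ2 hy.le, sub_zero]
    have ht : LipTest Ω fun x => κ x * ζ x := hκ.mul_lipschitz hC fun x hx => hκ.sub hx.1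
    rw [← green_eq_zero_of_differentiableOn D.isOpen D.intw D.intg D.div (hcomp n).1.diff
      (hcomp n).1.intq ht]
    refine setIntegral_congr_fun D.measurableSet fun x hx => ?_
    by_cases hxs : x ∈ tsupport ζ
    · by_cases hxF : r n ≤ |F x|
      · have e1 := hκ1 x ⟨⟨subset_closure hx, hxs⟩, hxF⟩
        have e2 : (fun x => κ x * ζ x) =ᶠ[𝓝 x] ζ := by
          filter_upwards [e1] with y hy
          simp [hy]
        simp only [greenFun]
        rw [e2.fderiv_eq, e2.eq_of_nhds]
      · have h1 : trunc (r n) (F x) = 0 := trunc_eq_zero (hr n) (not_le.1 hxF).le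
        have h2 : ramp {(0 : ℝ)} (r n) (F x) = 0 := ramp_eq_zero (hr n) (by
          rw [infDist_singleton, Real.dist_eq, sub_zero]; exact (not_le.1 hxF).le)
        simp [greenFun, (hcomp n).2 x hx, h1, h2]
    · have e2 : (fun x => κ x * ζ x) =ᶠ[𝓝 x] ζ := by
        filter_upwards [(isClosed_tsupport ζ).isOpen_compl.mem_nhds hxs] with y hy
        simp [image_eq_zero_of_notMem_tsupport hy]
      simp only [greenFun]
      rw [e2.fderiv_eq, e2.eq_of_nhds]
  have hlim : Tendsto (fun n => green μ Ω w g (fun x => trunc (r n) (F x)) ζ) atTop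
      (𝓝 (green μ Ω w g F ζ)) := by
    have hFM : ∀ x ∈ Ω, x ∈ tsupport ζ → |F x| ≤ M := fun x hx hxs =>
      hM x ⟨subset_closure hx, hxs⟩
    have i1 := integrableOn_bdd_mul hF.intq hC.continuous hB
    have i2 := integrableOn_mul_fderiv D.measurableSet D.intw hFm hFM hC
    have i3 := integrableOn_mul_mul D.measurableSet D.intg hFm hFM hC.continuous hB
    refine tendsto_integral_of_dominated_convergence
      (fun x => ‖ζ x * fderiv ℝ F x (w x)‖ + ‖F x * fderiv ℝ ζ x (w x)‖ + ‖g x * F x * ζ x‖)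
      ?_ ((i1.norm.add i2.norm).add i3.norm) ?_ ?_
    · intro n
      exact (integrableOn_greenFun D.measurableSet D.intw D.intg
        ((hcomp n).1.aestronglyMeasurable D) (hcomp n).1.intq
        (fun x hx hxs => (abs_trunc_le _ _).trans (hFM x hx hxs)) hC hB).aestronglyMeasurable
    · intro n
      filter_upwards [ae_restrict_mem D.measurableSet] with x hx
      have h1 : ‖trunc (r n) (F x)‖ ≤ ‖F x‖ := abs_trunc_le _ _
      have h2 : ‖ramp {(0 : ℝ)} (r n) (F x)‖ ≤ 1 := abs_ramp_le_one _ _ _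
      refine (norm_add₃_le).trans (add_le_add (add_le_add ?_ ?_) ?_)
      · rw [(hcomp n).2 x hx, norm_mul, norm_mul]
        gcongr
        rw [smul_apply, smul_eq_mul, norm_mul]
        exact mul_le_of_le_one_left (norm_nonneg _) h2
      · rw [norm_mul, norm_mul]
        gcongr
      · rw [norm_mul, norm_mul, norm_mul, norm_mul]
        gcongr
    · have hS : MeasurableSet {x ∈ Ω | F x = 0} := by
        have := hF.diff.continuousOn.isOpen_inter_preimage D.isOpen (isOpen_compl_singleton (x := (0:ℝ)))
        have h2 := D.measurableSet.diff this.measurableSet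
        convert h2 using 1
        ext x
        simp only [mem_ofPred_eq, Set.mem_sdiff, mem_inter_iff, mem_preimage, mem_compl_iff,
          mem_singleton_iff]
        tauto
      have hSae := ae_fderiv_eq_zero_of_eq_zero (μ := μ) hS
        (fun x hx => hF.differentiableAt D hx.1) (fun x hx => hx.2)
      rw [ae_restrict_iff' hS] at hSae
      filter_upwards [ae_restrict_mem D.measurableSet, ae_restrict_of_ae hSae] with x hx h1
      have ht := tendsto_trunc (F x)
      have h3 : Tendsto (fun n => fderiv ℝ (fun x => trunc (r n) (F x)) x (w x)) atTop
          (𝓝 (fderiv ℝ F x (w x))) := by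
        by_cases hF0 : F x = 0
        · refine tendsto_const_nhds.congr fun n => ?_
          simp [(hcomp n).2 x hx, h1 ⟨hx, hF0⟩]
        · refine tendsto_const_nhds.congr' ?_
          filter_upwards [eventually_ramp_eq_one (Z := {(0 : ℝ)}) (x := F x)
            (by rw [infDist_singleton]; exact dist_pos.2 hF0)] with n hn
          rw [(hcomp n).2 x hx, hn, one_smul]
      exact ((h3.const_mul _).add (ht.mul_const _)).add ((ht.const_mul _).mul_const _)
  simp_rw [hn] at hlim
  exact tendsto_nhds_unique hlim tendsto_const_nhds

end BoundaryGreen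

section BoundaryFlux

open Filter Topology Metric

variable {E : Type*} [NormedAddCommGroup E] [NormedSpace ℝ E] [MeasurableSpace E]
  [FiniteDimensional ℝ E] [BorelSpace E] {μ : Measure E} [μ.IsAddHaarMeasure]
  {Ω Z : Set E} {w : E → E} {g : E → ℝ}

theorem tendsto_green_ramp (D : GreenData μ Ω Z w g) {f : E → ℝ} (hf : GreenTest μ Ω Z w g f)
    {M : ℝ} (hM : ∀ x ∈ Ω, |f x| ≤ M) :
    Tendsto (fun n : ℕ => green μ Ω w g f (ramp Z (1 / ((n : ℝ) + 1)))) atTop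
      (𝓝 (gpair μ Ω w g f)) := by
  let r : ℕ → ℝ := fun n => 1 / ((n : ℝ) + 1)
  have hr : ∀ n, 0 < r n := fun n => by positivity
  have hfm := hf.aestronglyMeasurable D
  have hc := fun n => (lipschitzWith_ramp Z (hr n)).continuous
  have i1 := fun n => integrableOn_bdd_mul hf.integrableOn (hc n) (abs_ramp_le_one Z (r n))
  have i2 := fun n => integrableOn_mul_fderiv (ζ := ramp Z (r n)) D.measurableSet D.intw hfm
    (fun x hx _ => hM x hx) (lipschitzWith_ramp Z (hr n))
  have e : ∀ n, green μ Ω w g f (ramp Z (r n)) =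
      (∫ x in Ω, ramp Z (r n) x * (fderiv ℝ f x (w x) + g x * f x) ∂μ) +
        ∫ x in Ω, f x * fderiv ℝ (ramp Z (r n)) x (w x) ∂μ := by
    intro n
    rw [green, ← integral_add (i1 n) (i2 n)]
    congr 1
    ext x
    simp only [greenFun]
    ring
  have t1 : Tendsto (fun n => ∫ x in Ω, ramp Z (r n) x * (fderiv ℝ f x (w x) + g x * f x) ∂μ)
      atTop (𝓝 (gpair μ Ω w g f)) := by
    refine tendsto_integral_of_dominated_convergence _ (fun n => (i1 n).aestronglyMeasurable)
      hf.integrableOn.norm (fun n => Eventually.of_forall fun x => ?_) ?_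
    · rw [norm_mul]
      exact mul_le_of_le_one_left (norm_nonneg _) (abs_ramp_le_one _ _ _)
    · have h0 : ∀ᵐ x ∂μ, x ∉ Z := by
        rw [ae_iff]; simpa using D.null
      filter_upwards [ae_restrict_of_ae h0] with x hx
      refine tendsto_const_nhds.congr' ?_
      filter_upwards [eventually_ramp_eq_one
        ((D.isClosed.notMem_iff_infDist_pos D.nonempty).1 hx)] with n hn
      simp only [r] at hn ⊢
      rw [hn, one_mul]
  have t2 : Tendsto (fun n => ∫ x in Ω, f x * fderiv ℝ (ramp Z (r n)) x (w x) ∂μ)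
      atTop (𝓝 0) := by
    have h1 := D.conc.const_mul |M|
    rw [mul_zero] at h1
    refine squeeze_zero_norm (fun n => ?_) h1
    have hS : MeasurableSet {x | infDist x Z ≤ 2 * r n} :=
      (isClosed_le (continuous_infDist_pt Z) continuous_const).measurableSet
    rw [← integral_const_mul, ← integral_const_mul, inter_comm, ← Measure.restrict_restrict hS,
      ← integral_indicator hS]
    refine norm_integral_le_of_norm_le
      (((D.intw.norm.const_mul _).const_mul _).indicator hS) ?_
    filter_upwards [ae_restrict_mem D.measurableSet] with x hx
    rcases le_or_gt (infDist x Z) (2 * r n) with hd | hd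
    · rw [indicator_of_mem (show x ∈ {x | infDist x Z ≤ 2 * r n} from hd), norm_mul]
      have h2 : ‖fderiv ℝ (ramp Z (r n)) x (w x)‖ ≤ 1 / r n * ‖w x‖ :=
        (ContinuousLinearMap.le_opNorm _ _).trans (by
          gcongr; exact norm_fderiv_ramp_le Z (hr n) x)
      have h3 : ‖f x‖ ≤ |M| := (hM x hx).trans (le_abs_self _)
      simp only [r, one_div_one_div] at h2
      simp only [r]
      gcongr
    · rw [indicator_of_notMem (show x ∉ {x | infDist x Z ≤ 2 * r n} from not_le.2 hd),
        fderiv_ramp_of_gt (hr n) hd]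
      simp
  have := t1.add t2
  rw [add_zero] at this
  exact this.congr fun n => (e n).symm

theorem gpair_eq_zero (D : GreenData μ Ω Z w g) {F : E → ℝ} (hF : GreenTest μ Ω Z w g F)
    (h0 : ∀ x ∈ closure Ω, x ∉ Ω → x ∉ Z → F x = 0) : gpair μ Ω w g F = 0 := by
  let k : ℕ → ℝ → ℝ := fun n t => ((n : ℝ) + 1) * Real.sin (t / ((n : ℝ) + 1))
  have hk : ∀ n t, HasDerivAt (k n) (Real.cos (t / ((n : ℝ) + 1))) t := by
    intro n t
    have h1 : ((n : ℝ) + 1) ≠ 0 := by positivity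
    have := (((hasDerivAt_id t).div_const ((n : ℝ) + 1)).sin).const_mul ((n : ℝ) + 1)
    exact this.congr_deriv (by simp; field_simp)
  have hkle : ∀ n t, |k n t| ≤ |t| := by
    intro n t
    have h1 : (0 : ℝ) < (n : ℝ) + 1 := by positivity
    have h2 := Real.abs_sin_le_abs (x := t / ((n : ℝ) + 1))
    rw [abs_mul, abs_of_pos h1]
    rw [abs_div, abs_of_pos h1, le_div_iff₀ h1] at h2
    linarith
  have hcomp := fun n => hF.comp D (hk n) (by fun_prop) (M := 1)
    (fun t => Real.abs_cos_le_one _) fun t => by simpa using hkle n t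
  have hz : ∀ n, gpair μ Ω w g (fun x => k n (F x)) = 0 := by
    intro n
    refine tendsto_nhds_unique (tendsto_green_ramp D (hcomp n).1 (M := (n : ℝ) + 1) ?_) ?_
    · intro x _
      have h1 : (0 : ℝ) < (n : ℝ) + 1 := by positivity
      rw [abs_mul, abs_of_pos h1]
      exact mul_le_of_le_one_right h1.le (Real.abs_sin_le_one _)
    · refine tendsto_const_nhds.congr fun m => ?_
      have hm : 0 < 1 / ((m : ℝ) + 1) := by positivity
      have hnotZ : ∀ x ∈ tsupport (ramp Z (1 / ((m : ℝ) + 1))), x ∉ Z := fun x hx hxZ => by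
        have h1 := tsupport_ramp_subset hm hx
        rw [mem_ofPred_eq, infDist_zero_of_mem hxZ] at h1
        linarith
      refine (green_eq_zero_of_frontier D (hcomp n).1 (lipschitzWith_ramp Z hm)
        (abs_ramp_le_one Z _) hnotZ fun x h1 h2 h3 => ?_).symm
      simp [k, h0 x h1 h2 (hnotZ x h3)]
  have hlim : Tendsto (fun n => gpair μ Ω w g (fun x => k n (F x))) atTop
      (𝓝 (gpair μ Ω w g F)) := by
    refine tendsto_integral_of_dominated_convergence
      (fun x => ‖fderiv ℝ F x (w x)‖ + ‖g x * F x‖)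
      (fun n => (hcomp n).1.integrableOn.aestronglyMeasurable)
      (hF.intq.norm.add hF.intg.norm) ?_ ?_
    · intro n
      filter_upwards [ae_restrict_mem D.measurableSet] with x hx
      refine (norm_add_le _ _).trans (add_le_add ?_ ?_)
      · rw [(hcomp n).2 x hx, smul_apply, smul_eq_mul, norm_mul]
        exact mul_le_of_le_one_left (norm_nonneg _) (Real.abs_cos_le_one _)
      · rw [norm_mul (g x), norm_mul (g x)]
        exact mul_le_mul_of_nonneg_left (hkle n _) (norm_nonneg _)
    · filter_upwards [ae_restrict_mem D.measurableSet] with x hx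
      have hd : Tendsto (fun n : ℕ => F x / ((n : ℝ) + 1)) atTop (𝓝 0) := by
        have := (tendsto_one_div_add_atTop_nhds_zero_nat (𝕜 := ℝ)).const_mul (F x)
        rw [mul_zero] at this
        exact this.congr fun n => by ring
      have t1 : Tendsto (fun n : ℕ => Real.cos (F x / ((n : ℝ) + 1))) atTop (𝓝 1) := by
        have := (Real.continuous_cos.tendsto 0).comp hd
        rwa [Real.cos_zero] at this
      have t2 : Tendsto (fun n : ℕ => k n (F x)) atTop (𝓝 (F x)) := by
        by_cases hF0 : F x = 0
        · simp [k, hF0]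
        have h1 : Tendsto (fun t : ℝ => Real.sin t / t) (𝓝[≠] 0) (𝓝 1) := by
          have := (Real.hasDerivAt_sin 0).tendsto_slope
          rw [Real.cos_zero] at this
          exact this.congr fun t => by rw [slope_def_field, Real.sin_zero, sub_zero, sub_zero]
        have h2 : Tendsto (fun n : ℕ => F x / ((n : ℝ) + 1)) atTop (𝓝[≠] 0) :=
          tendsto_nhdsWithin_iff.2 ⟨hd, Eventually.of_forall fun n => by
            simp only [mem_compl_iff, mem_singleton_iff]; positivity⟩
        have h3 := (h1.comp h2).const_mul (F x)
        rw [mul_one] at h3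
        refine h3.congr fun n => ?_
        have : ((n : ℝ) + 1) ≠ 0 := by positivity
        simp only [Function.comp, k]
        field_simp
      have h4 := t1.mul_const (fderiv ℝ F x (w x))
      rw [one_mul] at h4
      have h5 : Tendsto (fun n => fderiv ℝ (fun x => k n (F x)) x (w x)) atTop
          (𝓝 (fderiv ℝ F x (w x))) :=
        h4.congr fun n => by rw [(hcomp n).2 x hx, smul_apply, smul_eq_mul]
      exact h5.add (t2.const_mul _)
  simp_rw [hz] at hlim
  exact tendsto_nhds_unique hlim tendsto_const_nhds

theorem hasDerivAt_max_sq (t : ℝ) :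
    HasDerivAt (fun t : ℝ => max 0 (1 - t) ^ 2) (-(2 * max 0 (1 - t))) t := by
  rcases lt_trichotomy t 1 with h | h | h
  · have h1 : HasDerivAt (fun t : ℝ => (1 - t) ^ 2) (-(2 * (1 - t))) t := by
      have := ((hasDerivAt_id t).const_sub 1).pow 2
      exact this.congr_deriv (by simp)
    rw [max_eq_right (by linarith)]
    refine h1.congr_of_eventuallyEq ?_
    filter_upwards [eventually_lt_nhds h] with y hy
    rw [max_eq_right (by linarith)]
  · subst h
    have : HasDerivAt (fun t : ℝ => max 0 (1 - t) ^ 2) 0 1 := by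
      rw [hasDerivAt_iff_isLittleO_nhds_zero]
      simp only [sub_self, max_self, ne_eq, OfNat.ofNat_ne_zero, not_false_eq_true, zero_pow,
        sub_zero, smul_zero]
      have h2 : (fun h : ℝ => h ^ 2) =o[𝓝 0] fun h => h := by
        simpa using Asymptotics.isLittleO_pow_id (𝕜 := ℝ) (n := 2) (by norm_num)
      refine Asymptotics.IsBigO.trans_isLittleO
        (Asymptotics.IsBigO.of_bound 1 (Eventually.of_forall fun h => ?_)) h2
      rw [one_mul, norm_pow, norm_pow]
      gcongr
      rw [Real.norm_eq_abs, abs_of_nonneg (le_max_left _ _)]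
      refine max_le (norm_nonneg _) ?_
      rw [Real.norm_eq_abs]
      linarith [neg_abs_le h]
    simpa using this
  · rw [max_eq_left (by linarith)]
    have : HasDerivAt (fun _ : ℝ => (0 : ℝ)) (-(2 * 0)) t := by
      simpa using hasDerivAt_const t (0 : ℝ)
    refine this.congr_of_eventuallyEq ?_
    filter_upwards [eventually_gt_nhds h] with y hy
    rw [max_eq_left (by linarith)]
    simp

/-- The pairing with a function equal to `1` on the part `ℓ = 0` of the boundary and `0` on the
rest is controlled by averages of `∇ℓ · w` over thin strips. -/
theorem abs_gpair_le_of_strip (D : GreenData μ Ω Z w g) {f : E → ℝ}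
    (hf : GreenTest μ Ω Z w g f) {M : ℝ} (hM : ∀ x ∈ Ω, |f x| ≤ M) {ℓ : E → ℝ} {Λ : E →L[ℝ] ℝ}
    (hℓ : ∀ x, HasFDerivAt ℓ Λ x) (hpos : ∀ x ∈ Ω, 0 < ℓ x)
    (hbd : ∀ x ∈ closure Ω, x ∉ Ω → x ∉ Z →
      (ℓ x = 0 ∧ f x = 1) ∨ (f x = 0 ∧ infDist x Z ≤ ℓ x))
    {δ : ℕ → ℝ} (hδ : ∀ k, 0 < δ k) (hδ0 : Tendsto δ atTop (𝓝 0)) {L : ℝ}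
    (hL : ∀ k, (1 / δ k) * ∫ x in Ω ∩ {x | ℓ x < δ k}, |Λ (w x)| ∂μ ≤ L) :
    |gpair μ Ω w g f| ≤ 2 * L := by
  have hℓc : Continuous ℓ := continuous_iff_continuousAt.2 fun x => (hℓ x).continuousAt
  let η : ℕ → E → ℝ := fun k x => max 0 (1 - ℓ x / δ k) ^ 2
  have hηd : ∀ k x, HasFDerivAt (η k) ((-(2 * max 0 (1 - ℓ x / δ k)) * (1 / δ k)) • Λ) x := by
    intro k x
    have h1 : HasFDerivAt (fun x => ℓ x / δ k) ((1 / δ k) • Λ) x := by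
      have := (hℓ x).const_mul (1 / δ k)
      refine this.congr_of_eventuallyEq (Eventually.of_forall fun y => ?_)
      simp only []
      ring
    have := (hasDerivAt_max_sq (ℓ x / δ k)).comp_hasFDerivAt x h1
    rwa [smul_smul] at this
  have hηc : ∀ k, Continuous (η k) := fun k => by
    have : Continuous fun x => ℓ x / δ k := hℓc.div_const _
    fun_prop
  have hmax : ∀ k, ∀ x ∈ Ω, |max 0 (1 - ℓ x / δ k)| ≤ 1 := by
    intro k x hx
    have : 0 < ℓ x / δ k := div_pos (hpos x hx) (hδ k)
    rw [abs_of_nonneg (le_max_left _ _)]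
    exact max_le zero_le_one (by linarith)
  have hη1 : ∀ k, ∀ x ∈ Ω, |η k x| ≤ 1 := fun k x hx => by
    simp only [η]
    rw [abs_pow]
    exact pow_le_one₀ (abs_nonneg _) (hmax k x hx)
  have hΛw : IntegrableOn (fun x => Λ (w x)) Ω μ := Λ.integrable_comp D.intw
  have hq1 : ∀ k, ∀ x ∈ Ω, |fderiv ℝ (η k) x (w x)| ≤ 2 * (1 / δ k) * |Λ (w x)| := by
    intro k x hx
    rw [(hηd k x).fderiv, smul_apply, smul_eq_mul, abs_mul, abs_mul, abs_neg,
      abs_mul, abs_of_pos (show (0 : ℝ) < 1 / δ k from one_div_pos.2 (hδ k)), abs_two]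
    have h1 := hmax k x hx
    have h2 : 0 < 1 / δ k := one_div_pos.2 (hδ k)
    have : 2 * |max 0 (1 - ℓ x / δ k)| * (1 / δ k) ≤ 2 * 1 * (1 / δ k) := by gcongr
    have h3 := mul_le_mul_of_nonneg_right this (abs_nonneg (Λ (w x)))
    linarith
  have hηT : ∀ k, GreenTest μ Ω Z w g (η k) := by
    intro k
    refine ⟨fun x _ => (hηd k x).differentiableAt.differentiableWithinAt,
      (hηc k).continuousOn, ?_, ?_⟩
    · refine Integrable.mono' (hΛw.norm.const_mul (2 * (1 / δ k)))
        (aestronglyMeasurable_clm_apply (measurable_fderiv ℝ _).aestronglyMeasurable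
          D.intw.aestronglyMeasurable) ?_
      filter_upwards [ae_restrict_mem D.measurableSet] with x hx using hq1 k x hx
    · refine Integrable.mono' D.intg.norm
        (D.intg.aestronglyMeasurable.mul (hηc k).aestronglyMeasurable) ?_
      filter_upwards [ae_restrict_mem D.measurableSet] with x hx
      rw [norm_mul]
      exact mul_le_of_le_one_right (norm_nonneg _) (hη1 k x hx)
  refine le_of_tendsto (tendsto_green_ramp D hf hM).abs (Eventually.of_forall fun n => ?_)
  have hr : 0 < 1 / ((n : ℝ) + 1) := by positivity
  set r : ℝ := 1 / ((n : ℝ) + 1) with hrdef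
  have hζ := lipschitzWith_ramp Z hr
  have hZs : ∀ x ∈ tsupport (ramp Z r), r ≤ infDist x Z := fun x hx =>
    tsupport_ramp_subset hr hx
  have hnotZ : ∀ x ∈ tsupport (ramp Z r), x ∉ Z := fun x hx hxZ => by
    have h1 := hZs x hx
    rw [infDist_zero_of_mem hxZ] at h1
    linarith
  let S : ℕ → Set E := fun k => {x | ℓ x < δ k}
  have hS : ∀ k, MeasurableSet (S k) := fun k =>
    (isOpen_lt hℓc continuous_const).measurableSet
  let h : E → ℝ := fun x => 1 / r * ‖w x‖ + |g x|
  have hh : IntegrableOn h Ω μ := (D.intw.norm.const_mul _).add D.intg.norm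
  have hkey : ∀ᶠ k in atTop, |green μ Ω w g f (ramp Z r)| ≤
      2 * L + ∫ x in Ω, (S k).indicator h x ∂μ := by
    filter_upwards [hδ0.eventually_lt_const hr] with k hk
    have e0 := green_eq_zero_of_frontier D (hf.sub D (hηT k)) hζ (abs_ramp_le_one Z r) hnotZ
      fun x h1 h2 h3 => by
        rcases hbd x h1 h2 (hnotZ x h3) with ⟨h4, h5⟩ | ⟨h4, h5⟩
        · simp [η, h4, h5]
        · have : 1 ≤ ℓ x / δ k := by
            rw [le_div_iff₀ (hδ k)]
            linarith [hZs x h3]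
          simp only [η, h4]
          rw [max_eq_left (by linarith)]
          simp
    have i1 := integrableOn_greenFun D.measurableSet D.intw D.intg
      (hf.aestronglyMeasurable D) hf.intq (fun x hx _ => hM x hx) hζ (abs_ramp_le_one Z r)
    have i2 := integrableOn_greenFun D.measurableSet D.intw D.intg
      ((hηT k).aestronglyMeasurable D) (hηT k).intq (fun x hx _ => hη1 k x hx) hζ
      (abs_ramp_le_one Z r)
    have e1 : green μ Ω w g f (ramp Z r) - green μ Ω w g (η k) (ramp Z r) = 0 := by
      rw [← e0, green, green, green, ← integral_sub i1 i2]
      refine setIntegral_congr_fun D.measurableSet fun x hx => ?_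
      simp only [greenFun]
      rw [fderiv_fun_sub (hf.differentiableAt D hx) ((hηT k).differentiableAt D hx)]
      simp only [sub_apply]
      ring
    rw [sub_eq_zero.1 e1]
    have i3 : IntegrableOn (fun x => (S k).indicator (fun x => 2 * (1 / δ k) * |Λ (w x)|) x) Ω μ :=
      (hΛw.norm.const_mul (2 * (1 / δ k))).indicator (hS k)
    have i4 : IntegrableOn (fun x => (S k).indicator h x) Ω μ := hh.indicator (hS k)
    have b1 : |green μ Ω w g (η k) (ramp Z r)| ≤
        ∫ x in Ω, ((S k).indicator (fun x => 2 * (1 / δ k) * |Λ (w x)|) x +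
          (S k).indicator h x) ∂μ := by
      rw [← Real.norm_eq_abs, green]
      refine norm_integral_le_of_norm_le (i3.add i4) ?_
      filter_upwards [ae_restrict_mem D.measurableSet] with x hx
      by_cases hxS : x ∈ S k
      · rw [indicator_of_mem hxS, indicator_of_mem hxS]
        have a1 := abs_ramp_le_one Z r x
        have a2 := hη1 k x hx
        have a3 : |fderiv ℝ (ramp Z r) x (w x)| ≤ 1 / r * ‖w x‖ :=
          ((fderiv ℝ (ramp Z r) x).le_opNorm (w x)).trans (by
            gcongr; exact norm_fderiv_ramp_le Z hr x)
        simp only [greenFun]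
        refine (norm_add₃_le (E := ℝ)).trans ?_
        simp only [h]
        rw [← add_assoc]
        refine add_le_add (add_le_add ?_ ?_) ?_
        · rw [norm_mul]
          exact (mul_le_of_le_one_left (norm_nonneg _) a1).trans (hq1 k x hx)
        · rw [norm_mul]
          exact (mul_le_of_le_one_left (norm_nonneg _) a2).trans a3
        · rw [norm_mul, norm_mul]
          exact (mul_le_of_le_one_right (by positivity) a1).trans
            (mul_le_of_le_one_right (norm_nonneg _) a2)
      · rw [indicator_of_notMem hxS, indicator_of_notMem hxS]
        have : 1 ≤ ℓ x / δ k := by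
          rw [le_div_iff₀ (hδ k), one_mul]; exact not_lt.1 hxS
        have a1 : max 0 (1 - ℓ x / δ k) = 0 := max_eq_left (by linarith)
        simp [greenFun, (hηd k x).fderiv, a1, η]
    rw [integral_add i3 i4, integral_indicator (hS k), Measure.restrict_restrict (hS k),
      integral_const_mul, inter_comm] at b1
    have := hL k
    simp only [S] at b1 ⊢
    linarith
  have hlim : Tendsto (fun k => 2 * L + ∫ x in Ω, (S k).indicator h x ∂μ) atTop
      (𝓝 (2 * L + ∫ x in Ω, (0 : ℝ) ∂μ)) := by
    refine Tendsto.const_add _ (tendsto_integral_of_dominated_convergence (fun x => ‖h x‖)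
      (fun k => (hh.indicator (hS k)).aestronglyMeasurable) hh.norm
      (fun k => Eventually.of_forall fun x => norm_indicator_le_norm_self _ _) ?_)
    filter_upwards [ae_restrict_mem D.measurableSet] with x hx
    refine tendsto_const_nhds.congr' ?_
    filter_upwards [hδ0.eventually_lt_const (hpos x hx)] with k hk
    rw [indicator_of_notMem (show x ∉ S k from fun h => lt_asymm h hk)]
  simpa using ge_of_tendsto hlim hkey

end BoundaryFlux

section Triangle

open Filter Topology Metric

theorem abs_integral_le_sqrt_mul_sqrt {α : Type*} [MeasurableSpace α] {ν : Measure α}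
    [IsFiniteMeasure ν] {f : α → ℝ} (hf : Integrable f ν) (hf2 : Integrable (fun x => f x ^ 2) ν) :
    |∫ x, f x ∂ν| ≤ √(ν.real univ) * √(∫ x, f x ^ 2 ∂ν) := by
  rw [← Real.sqrt_mul measureReal_nonneg]
  refine Real.abs_le_sqrt ?_
  set V := ν.real univ with hV
  set I := ∫ x, f x ∂ν with hI
  have h0 : 0 ≤ ∫ x, (V ^ 2 * f x ^ 2 - (2 * V * I) * f x + I ^ 2) ∂ν :=
    integral_nonneg fun x => by
      have := sq_nonneg (V * f x - I)
      simp only [Pi.zero_apply]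
      nlinarith
  have i1 := hf2.const_mul (V ^ 2)
  have i2 := hf.const_mul (2 * V * I)
  have i3 : Integrable (fun x => V ^ 2 * f x ^ 2 - 2 * V * I * f x) ν := i1.sub i2
  rw [integral_add i3 (integrable_const _),
    integral_sub i1 i2, integral_const_mul, integral_const_mul,
    integral_const, smul_eq_mul, ← hV, ← hI] at h0
  rcases (measureReal_nonneg : 0 ≤ ν.real univ).eq_or_lt with h | h
  · have h1 : ν = 0 := by
      rw [← Measure.measure_univ_eq_zero]
      exact (measureReal_eq_zero_iff (measure_ne_top _ _)).1 h.symm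
    have : I = 0 := by rw [hI, h1]; simp
    rw [this, hV, ← h]
    simp
  · rw [← hV] at h
    have h1 : 0 ≤ V * (V * ∫ x, f x ^ 2 ∂ν - I ^ 2) := by nlinarith
    linarith [nonneg_of_mul_nonneg_right h1 h]

/-- The corners of the reference triangle. -/
def corners : Set (ℝ × ℝ) := {(0, 0), (1, 0), (1, 1)}

theorem isOpen_That : IsOpen That := by
  have : That = {x : ℝ × ℝ | 0 < x.1} ∩ {x | x.1 < 1} ∩ {x | 0 < x.2} ∩ {x | x.2 < x.1} := by
    ext x; simp [That, and_assoc]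
  rw [this]
  refine ((IsOpen.inter ?_ ?_).inter ?_).inter ?_ <;> apply isOpen_lt <;> fun_prop

theorem That_subset : That ⊆ Ioo 0 1 ×ˢ Ioo 0 1 := fun _ ⟨h1, h2, h3, h4⟩ =>
  ⟨⟨h1, h2⟩, ⟨h3, h4.trans h2⟩⟩

theorem volume_That_le : volume That ≤ 1 := by
  refine (measure_mono That_subset).trans ?_
  rw [Measure.volume_eq_prod, Measure.prod_prod]
  simp

instance : IsFiniteMeasure (volume.restrict That) :=
  ⟨by rw [Measure.restrict_apply_univ]; exact volume_That_le.trans_lt ENNReal.one_lt_top⟩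

theorem measureReal_That_le : (volume.restrict That).real univ ≤ 1 := by
  rw [measureReal_restrict_apply_univ]
  exact ENNReal.toReal_le_of_le_ofReal zero_le_one (by simpa using volume_That_le)

theorem isBounded_That : Bornology.IsBounded That :=
  ((isBounded_Ioo 0 1).prod (isBounded_Ioo 0 1)).subset That_subset

theorem closure_That_subset : closure That ⊆ {x | x.1 ≤ 1 ∧ 0 ≤ x.2 ∧ x.2 ≤ x.1} := by
  refine closure_minimal (fun x ⟨h1, h2, h3, h4⟩ => ⟨h2.le, h3.le, h4.le⟩) ?_
  have : {x : ℝ × ℝ | x.1 ≤ 1 ∧ 0 ≤ x.2 ∧ x.2 ≤ x.1} =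
      {x : ℝ × ℝ | x.1 ≤ 1} ∩ {x | 0 ≤ x.2} ∩ {x | x.2 ≤ x.1} := by
    ext x; simp [and_assoc]
  rw [this]
  refine (IsClosed.inter ?_ ?_).inter ?_ <;> apply isClosed_le <;> fun_prop

theorem frontier_That_cases {x : ℝ × ℝ} (hx : x ∈ closure That) (hT : x ∉ That)
    (hZ : x ∉ corners) : ∃ t ∈ Ioo (0 : ℝ) 1, x = (t, 0) ∨ x = (1, t) ∨ x = (t, t) := by
  obtain ⟨a, b⟩ := x
  obtain ⟨h1, h2, h3⟩ := closure_That_subset hx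
  simp only [corners, mem_insert_iff, mem_singleton_iff, Prod.mk.injEq, not_or, not_and] at hZ
  obtain ⟨z1, z2, z3⟩ := hZ
  simp only at h1 h2 h3
  rcases h2.eq_or_lt with h | h
  · subst h
    have ha0 : a ≠ 0 := fun h => z1 h rfl
    have ha1 : a ≠ 1 := fun h => z2 h rfl
    exact ⟨a, ⟨lt_of_le_of_ne h3 ha0.symm, lt_of_le_of_ne h1 ha1⟩, Or.inl rfl⟩
  · rcases h3.eq_or_lt with h' | h'
    · subst h'
      exact ⟨b, ⟨h, lt_of_le_of_ne h1 fun e => z3 e e⟩, Or.inr (Or.inr rfl)⟩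
    · rcases h1.eq_or_lt with e | e
      · subst e
        exact ⟨b, ⟨h, h'⟩, Or.inr (Or.inl rfl)⟩
      · exact absurd ⟨h.trans h', e, h, h'⟩ hT

theorem corners_finite : corners.Finite := by
  unfold corners; exact toFinite _

theorem volume_near_corners_le {r : ℝ} (hr : 0 ≤ r) :
    volume {x : ℝ × ℝ | infDist x corners ≤ r} ≤ ENNReal.ofReal (12 * r ^ 2) := by
  have hsub : {x : ℝ × ℝ | infDist x corners ≤ r} ⊆ ⋃ z ∈ corners, closedBall z r := by
    intro x hx
    have hne : corners.Nonempty := ⟨(0, 0), by simp [corners]⟩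
    obtain ⟨z, hz, he⟩ := corners_finite.isCompact.exists_infDist_eq_dist hne x
    exact mem_biUnion hz (by rw [mem_closedBall, ← he]; exact hx)
  have hball : ∀ z : ℝ × ℝ, volume (closedBall z r) = ENNReal.ofReal (4 * r ^ 2) := by
    intro z
    rw [← closedBall_prod_same, Measure.volume_eq_prod, Measure.prod_prod, Real.volume_closedBall,
      Real.volume_closedBall, ← ENNReal.ofReal_mul (by positivity)]
    congr 1; ring
  refine (measure_mono hsub).trans ?_
  have : (⋃ z ∈ corners, closedBall z r) =
      closedBall ((0, 0) : ℝ × ℝ) r ∪ (closedBall (1, 0) r ∪ closedBall (1, 1) r) := by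
    simp [corners, iUnion_or, iUnion_union_distrib]
  rw [this]
  refine (measure_union_le _ _).trans ((add_le_add le_rfl (measure_union_le _ _)).trans ?_)
  rw [hball, hball, hball, ← ENNReal.ofReal_add (by positivity) (by positivity),
    ← ENNReal.ofReal_add (by positivity) (by positivity)]
  refine ENNReal.ofReal_le_ofReal ?_
  linarith

theorem integrableOn_of_sq {u : ℝ × ℝ → ℝ} (hm : AEStronglyMeasurable u (volume.restrict That))
    (h2 : IntegrableOn (fun x => u x ^ 2) That) : IntegrableOn u That := by
  refine Integrable.mono' (h2.add (integrable_const (1 : ℝ))) hm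
    (Eventually.of_forall fun x => ?_)
  simp only [Pi.add_apply, Real.norm_eq_abs]
  nlinarith [sq_nonneg (|u x| - 1), sq_abs (u x), abs_nonneg (u x)]

theorem tendsto_conc_corners {w : ℝ × ℝ → ℝ × ℝ} (hw : IntegrableOn w That)
    (hw2 : IntegrableOn (fun x => ‖w x‖ ^ 2) That) :
    Tendsto (fun n : ℕ => ((n : ℝ) + 1) *
      ∫ x in That ∩ {x | infDist x corners ≤ 2 * (1 / ((n : ℝ) + 1))}, ‖w x‖) atTop (𝓝 0) := by
  let S : ℕ → Set (ℝ × ℝ) := fun n => {x | infDist x corners ≤ 2 * (1 / ((n : ℝ) + 1))}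
  have hS : ∀ n, MeasurableSet (S n) := fun n =>
    (isClosed_le (continuous_infDist_pt _) continuous_const).measurableSet
  have hTm := isOpen_That.measurableSet
  have hlim : Tendsto (fun n => ∫ x in That, (S n).indicator (fun x => ‖w x‖ ^ 2) x) atTop
      (𝓝 (∫ x in That, (0 : ℝ))) := by
    refine tendsto_integral_of_dominated_convergence (fun x => ‖‖w x‖ ^ 2‖)
      (fun n => (hw2.indicator (hS n)).aestronglyMeasurable) hw2.norm
      (fun n => Eventually.of_forall fun x => norm_indicator_le_norm_self _ _) ?_
    have h0 : ∀ᵐ x : ℝ × ℝ, x ∉ corners := by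
      rw [ae_iff]; simpa using corners_finite.measure_zero _
    filter_upwards [ae_restrict_of_ae h0] with x hx
    refine tendsto_const_nhds.congr' ?_
    have hd := (corners_finite.isClosed.notMem_iff_infDist_pos ⟨(0, 0), by simp [corners]⟩).1 hx
    filter_upwards [(tendsto_one_div_add_atTop_nhds_zero_nat (𝕜 := ℝ)).eventually_lt_const
      (half_pos hd)] with n hn
    rw [indicator_of_notMem]
    simp only [S, mem_ofPred_eq, not_le]
    linarith
  rw [integral_zero] at hlim
  have h2 := (hlim.sqrt).const_mul √48
  rw [Real.sqrt_zero, mul_zero] at h2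
  refine squeeze_zero (fun n => ?_) (fun n => ?_) h2
  · have : 0 ≤ ∫ x in That ∩ S n, ‖w x‖ := integral_nonneg fun x => norm_nonneg _
    positivity
  · have hn : (0 : ℝ) < (n : ℝ) + 1 := by positivity
    have : IsFiniteMeasure (volume.restrict (That ∩ S n)) :=
      ⟨by
        rw [Measure.restrict_apply_univ]
        exact (measure_mono inter_subset_left).trans_lt
          (volume_That_le.trans_lt ENNReal.one_lt_top)⟩
    have h3 := abs_integral_le_sqrt_mul_sqrt (ν := volume.restrict (That ∩ S n))
      (f := fun x => ‖w x‖) (IntegrableOn.mono_set (s := That ∩ S n) hw.norm inter_subset_left)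
      (hw2.mono_set inter_subset_left)
    have hvol : (volume.restrict (That ∩ S n)).real univ ≤ 48 * (1 / ((n : ℝ) + 1)) ^ 2 := by
      rw [measureReal_restrict_apply_univ]
      refine ENNReal.toReal_le_of_le_ofReal (by positivity) ?_
      refine (measure_mono inter_subset_right).trans
        ((volume_near_corners_le (by positivity)).trans ?_)
      refine ENNReal.ofReal_le_ofReal ?_
      nlinarith
    have h4 : √((volume.restrict (That ∩ S n)).real univ) ≤ √48 * (1 / ((n : ℝ) + 1)) := by
      refine (Real.sqrt_le_sqrt hvol).trans ?_
      rw [Real.sqrt_mul (by norm_num), Real.sqrt_sq (by positivity)]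
    rw [integral_indicator (hS n), Measure.restrict_restrict (hS n), inter_comm (S n)]
    change ((n : ℝ) + 1) * ∫ x in That ∩ S n, ‖w x‖ ≤ _
    have h5 := (le_abs_self _).trans (h3.trans (mul_le_mul_of_nonneg_right h4 (Real.sqrt_nonneg _)))
    calc _ ≤ ((n : ℝ) + 1) * (√48 * (1 / ((n : ℝ) + 1)) * √(∫ x in That ∩ S n, ‖w x‖ ^ 2)) := by
          gcongr
      _ = _ := by field_simp

end Triangle

section Fluxes

open Filter Topology Metric

theorem clm_apply_eq_pd (φ : ℝ × ℝ → ℝ) (x : ℝ × ℝ) (a b : ℝ) :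
    fderiv ℝ φ x (a, b) = a * pd1 φ x + b * pd2 φ x := by
  have : ((a, b) : ℝ × ℝ) = a • (1, 0) + b • (0, 1) := by simp
  rw [this, map_add, map_smul, map_smul]
  rfl

variable {u1 u2 dv : ℝ × ℝ → ℝ}

theorem greenData_That (m1 : AEStronglyMeasurable u1 (volume.restrict That))
    (m2 : AEStronglyMeasurable u2 (volume.restrict That))
    (md : AEStronglyMeasurable dv (volume.restrict That))
    (h1 : IntegrableOn (fun x => u1 x ^ 2) That) (h2 : IntegrableOn (fun x => u2 x ^ 2) That)
    (hd : IntegrableOn (fun x => dv x ^ 2) That)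
    (hdiv : ∀ ψ : ℝ × ℝ → ℝ, ContDiff ℝ (⊤ : ℕ∞) ψ → HasCompactSupport ψ → tsupport ψ ⊆ That →
        (∫ x in That, (u1 x * pd1 ψ x + u2 x * pd2 ψ x)) = -∫ x in That, dv x * ψ x) :
    GreenData volume That corners (fun x => (u1 x, u2 x)) dv := by
  have i1 := integrableOn_of_sq m1 h1
  have i2 := integrableOn_of_sq m2 h2
  have id := integrableOn_of_sq md hd
  have iw : IntegrableOn (fun x => (u1 x, u2 x)) That := Integrable.prodMk i1 i2
  have iw2 : IntegrableOn (fun x => ‖(u1 x, u2 x)‖ ^ 2) That := by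
    refine Integrable.mono' (h1.add h2) (iw.aestronglyMeasurable.norm.pow 2)
      (Eventually.of_forall fun x => ?_)
    rw [Real.norm_of_nonneg (by positivity), Prod.norm_def]
    simp only [Pi.add_apply]
    rcases max_choice ‖u1 x‖ ‖u2 x‖ with h | h <;> simp only [h] <;>
      rw [Real.norm_eq_abs, sq_abs] <;> nlinarith [sq_nonneg (u1 x), sq_nonneg (u2 x)]
  refine ⟨isOpen_That, isBounded_That, corners_finite.isClosed, ⟨(0, 0), by simp [corners]⟩,
    corners_finite.measure_zero _, iw, id, fun ψ hψ hc hs => ?_, tendsto_conc_corners iw iw2⟩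
  obtain ⟨B, hB⟩ := hc.exists_bound_of_continuous hψ.continuous
  have j2 : IntegrableOn (fun x => dv x * ψ x) That :=
    Integrable.mul_bdd (c := B) id hψ.continuous.aestronglyMeasurable (Eventually.of_forall hB)
  obtain ⟨B', hB'⟩ := (hc.fderiv (𝕜 := ℝ)).exists_bound_of_continuous
    (hψ.continuous_fderiv (by simp))
  have j1 : IntegrableOn (fun x => fderiv ℝ ψ x (u1 x, u2 x)) That := by
    refine Integrable.mono' (iw.norm.const_mul B') (aestronglyMeasurable_clm_apply
      (measurable_fderiv ℝ ψ).aestronglyMeasurable iw.aestronglyMeasurable)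
      (Eventually.of_forall fun x => ?_)
    exact (ContinuousLinearMap.le_opNorm _ _).trans (by gcongr; exact hB' x)
  have := hdiv ψ hψ hc hs
  rw [integral_add j1 j2]
  simp only [clm_apply_eq_pd]
  rw [this, neg_add_cancel]

theorem Adm.greenTest {ε w1 w2 w3 : ℝ} {φ : ℝ × ℝ → ℝ} (h : Adm ε u1 u2 dv φ w1 w2 w3) :
    GreenTest volume That corners (fun x => (u1 x, u2 x)) dv φ :=
  ⟨h.diff, h.cont, by simpa only [clm_apply_eq_pd] using h.int1, h.int2⟩

theorem Adm.pairing_eq {ε w1 w2 w3 : ℝ} {φ : ℝ × ℝ → ℝ} (h : Adm ε u1 u2 dv φ w1 w2 w3) :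
    pairing u1 u2 dv φ = gpair volume That (fun x => (u1 x, u2 x)) dv φ := by
  rw [pairing, gpair, ← integral_add h.int1 h.int2]
  simp only [clm_apply_eq_pd]

theorem abs_add_pairing_le (D : GreenData volume That corners (fun x => (u1 x, u2 x)) dv)
    (hd : IntegrableOn (fun x => dv x ^ 2) That) {ε : ℝ} {φ1 φ2 φ3 : ℝ × ℝ → ℝ}
    (a1 : Adm ε u1 u2 dv φ1 1 0 0) (a2 : Adm ε u1 u2 dv φ2 0 1 0) (a3 : Adm ε u1 u2 dv φ3 0 0 1) :
    |pairing u1 u2 dv φ1 + pairing u1 u2 dv φ2 + pairing u1 u2 dv φ3| ≤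
      √(∫ x in That, dv x ^ 2) := by
  have t12 := a1.greenTest.add D a2.greenTest
  have t := t12.add D a3.greenTest
  have t1 : GreenTest volume That corners (fun x => (u1 x, u2 x)) dv fun _ => (1 : ℝ) :=
    ⟨differentiableOn_const _, continuousOn_const, by simp [IntegrableOn],
      by simpa using D.intg⟩
  have h0 := gpair_eq_zero D (t.sub D t1) fun x h1 h2 h3 => by
    obtain ⟨s, hs, rfl | rfl | rfl⟩ := frontier_That_cases h1 h2 h3
    · simp [a1.bottom s hs, a2.bottom s hs, a3.bottom s hs]
    · simp [a1.right s hs, a2.right s hs, a3.right s hs]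
    · simp [a1.oblique s hs, a2.oblique s hs, a3.oblique s hs]
  rw [t.gpair_sub D t1, t12.gpair_add D a3.greenTest, a1.greenTest.gpair_add D a2.greenTest,
    ← a1.pairing_eq, ← a2.pairing_eq, ← a3.pairing_eq, sub_eq_zero] at h0
  rw [h0]
  have e : gpair volume That (fun x => (u1 x, u2 x)) dv (fun _ => 1) = ∫ x in That, dv x := by
    simp [gpair]
  rw [e]
  refine (abs_integral_le_sqrt_mul_sqrt D.intg hd).trans
    (mul_le_of_le_one_left (Real.sqrt_nonneg _) ?_)
  exact (Real.sqrt_le_sqrt measureReal_That_le).trans_eq Real.sqrt_one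

/-- Flux bound through an edge by strip averages, for an admissible function with boundary
values `0` and `1`. -/
theorem abs_pairing_le (D : GreenData volume That corners (fun x => (u1 x, u2 x)) dv)
    {ε w1 w2 w3 : ℝ} {φ : ℝ × ℝ → ℝ} (a : Adm ε u1 u2 dv φ w1 w2 w3)
    {ℓ : ℝ × ℝ → ℝ} {Λ : ℝ × ℝ →L[ℝ] ℝ}
    (hℓ : ∀ x, HasFDerivAt ℓ Λ x) (hpos : ∀ x ∈ That, 0 < ℓ x)
    (hbd : ∀ x ∈ closure That, x ∉ That → x ∉ corners →
      (ℓ x = 0 ∧ φ x = 1) ∨ (φ x = 0 ∧ infDist x corners ≤ ℓ x))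
    {L : ℝ} (hL : ∀ k : ℕ, ((2 : ℝ) ^ (k + 1)) *
      ∫ x in That ∩ {x | ℓ x < 1 / 2 ^ (k + 1)}, |Λ (u1 x, u2 x)| ≤ L) :
    |pairing u1 u2 dv φ| ≤ 2 * L := by
  have hder : ∀ t : ℝ, HasDerivAt (fun t => Real.sin (Real.pi / 2 * t))
      (Real.cos (Real.pi / 2 * t) * (Real.pi / 2)) t := fun t => by
    have := ((hasDerivAt_id t).const_mul (Real.pi / 2)).sin
    exact this.congr_deriv (by simp)
  have hp : (0 : ℝ) < Real.pi / 2 := by positivity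
  have tf := (a.greenTest.comp D hder (by fun_prop) (M := Real.pi / 2)
    (fun t => by
      rw [abs_mul, abs_of_pos hp]
      exact mul_le_of_le_one_left hp.le (Real.abs_cos_le_one _))
    (fun t => Real.abs_sin_le_abs.trans (by rw [abs_mul, abs_of_pos hp]))).1
  have h0 := gpair_eq_zero D (a.greenTest.sub D tf) fun x h1 h2 h3 => by
    rcases hbd x h1 h2 h3 with ⟨-, h⟩ | ⟨h, -⟩ <;> simp [h]
  rw [a.greenTest.gpair_sub D tf, ← a.pairing_eq, sub_eq_zero] at h0
  rw [h0]
  refine abs_gpair_le_of_strip D tf (M := 1) (fun x _ => Real.abs_sin_le_one _) hℓ hpos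
    (fun x h1 h2 h3 => ?_) (δ := fun k => 1 / 2 ^ (k + 1)) (fun k => by positivity) ?_ ?_
  · rcases hbd x h1 h2 h3 with ⟨h, h'⟩ | ⟨h, h'⟩
    · left; simp [h, h']
    · right; simp [h, h']
  · have := (tendsto_pow_atTop_nhds_zero_of_lt_one (r := (1 / 2 : ℝ)) (by norm_num)
      (by norm_num)).comp (tendsto_add_atTop_nat 1)
    exact this.congr fun k => by simp
  · intro k
    simpa using hL k

theorem abs_pairing_right_le (D : GreenData volume That corners (fun x => (u1 x, u2 x)) dv)
    {ε : ℝ} {φ : ℝ × ℝ → ℝ} (a : Adm ε u1 u2 dv φ 0 1 0)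
    {L : ℝ} (hL : ∀ k : ℕ, ((2 : ℝ) ^ (k + 1)) *
      ∫ x in That ∩ {x | 1 - x.1 < 1 / 2 ^ (k + 1)}, |u1 x| ≤ L) :
    |pairing u1 u2 dv φ| ≤ 2 * L := by
  refine abs_pairing_le D a (ℓ := fun x => 1 - x.1) (Λ := -ContinuousLinearMap.fst ℝ ℝ ℝ)
    (fun x => (ContinuousLinearMap.fst ℝ ℝ ℝ).hasFDerivAt.const_sub 1)
    (fun x hx => sub_pos.2 hx.2.1) (fun x h1 h2 h3 => ?_) (by simpa using hL)
  obtain ⟨s, hs, rfl | rfl | rfl⟩ := frontier_That_cases h1 h2 h3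
  · refine Or.inr ⟨a.bottom s hs, (infDist_le_dist_of_mem (y := (1, 0)) (by simp [corners])).trans ?_⟩
    simp only [Prod.dist_eq, Real.dist_eq, sub_self, abs_zero]
    exact max_le (by rw [abs_sub_comm, abs_of_pos (by linarith [hs.2])]) (by linarith [hs.2])
  · exact Or.inl ⟨by simp, a.right s hs⟩
  · refine Or.inr ⟨a.oblique s hs, (infDist_le_dist_of_mem (y := (1, 1)) (by simp [corners])).trans ?_⟩
    simp only [Prod.dist_eq, Real.dist_eq, max_self]
    rw [abs_sub_comm, abs_of_pos (by linarith [hs.2])]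

theorem abs_pairing_bottom_le (D : GreenData volume That corners (fun x => (u1 x, u2 x)) dv)
    {ε : ℝ} {φ : ℝ × ℝ → ℝ} (a : Adm ε u1 u2 dv φ 1 0 0)
    {L : ℝ} (hL : ∀ k : ℕ, ((2 : ℝ) ^ (k + 1)) *
      ∫ x in That ∩ {x | x.2 < 1 / 2 ^ (k + 1)}, |u2 x| ≤ L) :
    |pairing u1 u2 dv φ| ≤ 2 * L := by
  refine abs_pairing_le D a (ℓ := fun x => x.2) (Λ := ContinuousLinearMap.snd ℝ ℝ ℝ)
    (fun x => (ContinuousLinearMap.snd ℝ ℝ ℝ).hasFDerivAt)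
    (fun x hx => hx.2.2.1) (fun x h1 h2 h3 => ?_) (by simpa using hL)
  obtain ⟨s, hs, rfl | rfl | rfl⟩ := frontier_That_cases h1 h2 h3
  · exact Or.inl ⟨by simp, a.bottom s hs⟩
  · refine Or.inr ⟨a.right s hs, (infDist_le_dist_of_mem (y := (1, 0)) (by simp [corners])).trans ?_⟩
    simp only [Prod.dist_eq, Real.dist_eq, sub_self, abs_zero, sub_zero]
    exact max_le hs.1.le (by rw [abs_of_pos hs.1])
  · refine Or.inr ⟨a.oblique s hs, (infDist_le_dist_of_mem (y := (0, 0)) (by simp [corners])).trans ?_⟩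
    simp only [Prod.dist_eq, Real.dist_eq, max_self, sub_zero]
    rw [abs_of_pos hs.1]

end Fluxes

section DyadicSquares

theorem measureReal_mul_setIntegral_abs_le {X : Type*} [MeasurableSpace X] {μ : Measure X}
    [SFinite μ] {L S : Set X} (hL : MeasurableSet L) (hS : MeasurableSet S) (hLS : L ⊆ S)
    (hfin : μ S ≠ ⊤) {v : X → ℝ} (hv : IntegrableOn v S μ) {K : X × X → ℝ}
    (hK : IntegrableOn K (S ×ˢ S) (μ.prod μ)) (hvK : ∀ x ∈ S, ∀ y ∈ S, |v x - v y| ≤ K (x, y)) :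
    μ.real S * ∫ x in L, |v x| ∂μ ≤
      μ.real L * ∫ x in S, |v x| ∂μ + ∫ z in S ×ˢ S, K z ∂μ.prod μ := by
  have hfinL : μ L ≠ ⊤ := ((measure_mono hLS).trans_lt hfin.lt_top).ne
  have : IsFiniteMeasure (μ.restrict S) :=
    ⟨by rw [Measure.restrict_apply_univ]; exact hfin.lt_top⟩
  have : IsFiniteMeasure (μ.restrict L) :=
    ⟨by rw [Measure.restrict_apply_univ]; exact hfinL.lt_top⟩
  have hva : Integrable (fun x => |v x|) (μ.restrict S) := Integrable.abs hv
  have hvL : Integrable (fun x => |v x|) (μ.restrict L) :=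
    hva.mono_measure (Measure.restrict_mono hLS le_rfl)
  have e1 : ∫ z in L ×ˢ S, |v z.1| ∂μ.prod μ = μ.real S * ∫ x in L, |v x| ∂μ := by
    rw [← Measure.prod_restrict, integral_fun_fst (fun x => |v x|), measureReal_restrict_apply_univ,
      smul_eq_mul]
  have e2 : ∫ z in L ×ˢ S, |v z.2| ∂μ.prod μ = μ.real L * ∫ x in S, |v x| ∂μ := by
    rw [← Measure.prod_restrict, integral_fun_snd (fun x => |v x|), measureReal_restrict_apply_univ,
      smul_eq_mul]
  have i1 : IntegrableOn (fun z : X × X => |v z.1|) (L ×ˢ S) (μ.prod μ) := by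
    rw [IntegrableOn, ← Measure.prod_restrict]
    exact hvL.comp_fst _
  have i2 : IntegrableOn (fun z : X × X => |v z.2|) (L ×ˢ S) (μ.prod μ) := by
    rw [IntegrableOn, ← Measure.prod_restrict]
    exact hva.comp_snd _
  have hsub : L ×ˢ S ⊆ S ×ˢ S := prod_mono hLS Subset.rfl
  have i3 : IntegrableOn K (L ×ˢ S) (μ.prod μ) := hK.mono_set hsub
  rw [← e1, ← e2]
  have h1 : ∫ z in L ×ˢ S, |v z.1| ∂μ.prod μ ≤ ∫ z in L ×ˢ S, (|v z.2| + K z) ∂μ.prod μ := by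
    refine setIntegral_mono_on i1 (i2.add i3) (hL.prod hS) fun z hz => ?_
    have := hvK z.1 (hLS hz.1) z.2 hz.2
    have h2 := abs_add_le (v z.1 - v z.2) (v z.2)
    rw [sub_add_cancel] at h2
    linarith
  rw [integral_add i2 i3] at h1
  refine h1.trans (add_le_add le_rfl (setIntegral_mono_set hK ?_ hsub.eventuallyLE))
  exact (ae_restrict_iff' (hS.prod hS)).2
    (Filter.Eventually.of_forall fun z hz => (abs_nonneg _).trans (hvK z.1 hz.1 z.2 hz.2))

variable {v : ℝ × ℝ → ℝ} {k : (ℝ × ℝ) × (ℝ × ℝ) → ℝ} {Λ r : ℝ}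

theorem volume_real_Ioc_prod {a b h l : ℝ} (hh : 0 ≤ h) (hl : 0 ≤ l) :
    volume.real (Ioc a (a + h) ×ˢ Ioc b (b + l)) = h * l := by
  rw [Measure.volume_eq_prod, measureReal_prod_prod, Real.volume_real_Ioc, Real.volume_real_Ioc]
  simp [hh, hl]

theorem half_strip_le {a b h p m : ℝ} (hΛ : 0 ≤ Λ) (k0 : ∀ z, 0 ≤ k z) (hh : 0 < h) (hp : 0 < p) (hm : 0 < m)
    (hv : IntegrableOn v (Ioc a (a + h) ×ˢ Ioc b (b + h)))
    (hk : IntegrableOn k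
      ((Ioc a (a + h) ×ˢ Ioc b (b + h)) ×ˢ (Ioc a (a + h) ×ˢ Ioc b (b + h))))
    (hvk : ∀ x ∈ Ioc a (a + h) ×ˢ Ioc b (b + h), ∀ y ∈ Ioc a (a + h) ×ˢ Ioc b (b + h),
      (v x - v y) ^ 2 ≤ Λ * h ^ 3 * p ^ 2 * k (x, y)) :
    2 / h * ∫ x in Ioc a (a + h / 2) ×ˢ Ioc b (b + h), |v x| ≤
      1 / h * (∫ x in Ioc a (a + h) ×ˢ Ioc b (b + h), |v x|) +
        (m * p * (∫ z in (Ioc a (a + h) ×ˢ Ioc b (b + h)) ×ˢ (Ioc a (a + h) ×ˢ Ioc b (b + h)), k z) +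
          Λ * (h * p) / m) := by
  set S := Ioc a (a + h) ×ˢ Ioc b (b + h) with hS
  have hSm : MeasurableSet S := measurableSet_Ioc.prod measurableSet_Ioc
  have vS : volume.real S = h * h := volume_real_Ioc_prod hh.le hh.le
  have vL : volume.real (Ioc a (a + h / 2) ×ˢ Ioc b (b + h)) = h / 2 * h :=
    volume_real_Ioc_prod (by positivity) hh.le
  have hfin : volume S ≠ ⊤ := by
    rw [hS, Measure.volume_eq_prod, Measure.prod_prod, Real.volume_Ioc, Real.volume_Ioc]
    exact (ENNReal.mul_lt_top ENNReal.ofReal_lt_top ENNReal.ofReal_lt_top).ne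
  have hSS : (volume.prod volume).real (S ×ˢ S) = h ^ 4 := by
    rw [measureReal_prod_prod, vS]; ring
  have hc : IntegrableOn (fun _ : (ℝ × ℝ) × (ℝ × ℝ) => Λ * p / m / 2) (S ×ˢ S)
      (volume.prod volume) :=
    integrableOn_const (by
      rw [Measure.prod_prod]; exact (ENNReal.mul_lt_top hfin.lt_top hfin.lt_top).ne)
  have hk' : IntegrableOn (fun z => m * h ^ 3 * p / 2 * k z) (S ×ˢ S) (volume.prod volume) :=
    Integrable.const_mul hk _
  have hK : IntegrableOn (fun z => m * h ^ 3 * p / 2 * k z + Λ * p / m / 2) (S ×ˢ S)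
      (volume.prod volume) := hk'.add hc
  have key := measureReal_mul_setIntegral_abs_le (L := Ioc a (a + h / 2) ×ˢ Ioc b (b + h))
    (measurableSet_Ioc.prod measurableSet_Ioc) hSm
    (prod_mono (Ioc_subset_Ioc_right (by linarith)) Subset.rfl) hfin hv hK fun x hx y hy => by
      have h1 := hvk x hx y hy
      set d := v x - v y
      have hq : 0 < m * h ^ 3 * p := by positivity
      have hA : 0 ≤ m * h ^ 3 * p * k (x, y) := mul_nonneg hq.le (k0 _)
      have hB : 0 ≤ Λ * p / m := by positivity
      have hAB : d ^ 2 ≤ (m * h ^ 3 * p * k (x, y)) * (Λ * p / m) :=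
        h1.trans_eq (by field_simp)
      refine (abs_le_of_sq_le_sq (b := (m * h ^ 3 * p * k (x, y) + Λ * p / m) / 2) ?_
        (by positivity)).trans_eq (by ring)
      nlinarith [sq_nonneg (m * h ^ 3 * p * k (x, y) - Λ * p / m)]
  rw [integral_add hk' hc, integral_const_mul, setIntegral_const, hSS, vS, vL, smul_eq_mul] at key
  rw [Measure.volume_eq_prod (ℝ × ℝ) (ℝ × ℝ)]
  set I := ∫ x in Ioc a (a + h / 2) ×ˢ Ioc b (b + h), |v x|
  set J := ∫ x in S, |v x|
  set G := ∫ z in S ×ˢ S, k z ∂volume.prod volume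
  have := mul_le_mul_of_nonneg_left key (show 0 ≤ 2 / h ^ 3 by positivity)
  calc 2 / h * I = 2 / h ^ 3 * (h * h * I) := by field_simp
    _ ≤ _ := this
    _ = _ := by field_simp

theorem dyadic_strip_le (hΛ : 0 ≤ Λ) (k0 : ∀ z, 0 ≤ k z) (hr : 0 < r) (hr1 : r < 1)
    {Q : Set (ℝ × ℝ)} (hv : IntegrableOn v Q) (hk : IntegrableOn k (Q ×ˢ Q))
    (hvk : ∀ x ∈ Q, ∀ y ∈ Q, ∀ n : ℕ, |x.1 - y.1| ≤ (1 / 2) ^ n → |x.2 - y.2| ≤ (1 / 2) ^ n →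
      (v x - v y) ^ 2 ≤ Λ * ((1 / 2) ^ n) ^ 3 * (r ^ n) ^ 2 * k (x, y))
    {m : ℝ} (hm : 0 < m) (j : ℕ) : ∀ (n : ℕ) (a b h : ℝ), h = (1 / 2) ^ n →
    Ioc a (a + h) ×ˢ Ioc b (b + h) ⊆ Q →
    2 ^ j / h * ∫ x in Ioc a (a + h / 2 ^ j) ×ˢ Ioc b (b + h), |v x| ≤
      1 / h * (∫ x in Ioc a (a + h) ×ˢ Ioc b (b + h), |v x|) +
        1 / (1 - r) * (m * r ^ n * (∫ z in (Ioc a (a + h) ×ˢ Ioc b (b + h)) ×ˢ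
          (Ioc a (a + h) ×ˢ Ioc b (b + h)), k z) + Λ * (h * r ^ n) / m) := by
  have hr' : 0 < 1 - r := sub_pos.2 hr1
  induction j with
  | zero =>
    intro n a b h hh hQ
    have hp : 0 < h := by rw [hh]; positivity
    have : 0 ≤ ∫ z in (Ioc a (a + h) ×ˢ Ioc b (b + h)) ×ˢ
          (Ioc a (a + h) ×ˢ Ioc b (b + h)), k z := integral_nonneg fun z => k0 z
    simp only [pow_zero, div_one]
    exact le_add_of_nonneg_right (by positivity)
  | succ j ih =>
    intro n a b h hh hQ
    have hp : 0 < h := by rw [hh]; positivity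
    have h2 : h / 2 = (1 / 2) ^ (n + 1) := by rw [hh, pow_succ]; ring
    set S := Ioc a (a + h) ×ˢ Ioc b (b + h) with hS
    set S1 := Ioc a (a + h / 2) ×ˢ Ioc b (b + h / 2) with hS1
    set S2 := Ioc a (a + h / 2) ×ˢ Ioc (b + h / 2) (b + h / 2 + h / 2) with hS2
    have hu : ∀ l : ℝ, Ioc a l ×ˢ Ioc b (b + h) =
        Ioc a l ×ˢ Ioc b (b + h / 2) ∪ Ioc a l ×ˢ Ioc (b + h / 2) (b + h / 2 + h / 2) := by
      intro l
      rw [← prod_union, Ioc_union_Ioc_eq_Ioc (by linarith) (by linarith)]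
      congr 2; ring
    have hdis : ∀ l : ℝ, Disjoint (Ioc a l ×ˢ Ioc b (b + h / 2))
        (Ioc a l ×ˢ Ioc (b + h / 2) (b + h / 2 + h / 2)) := by
      intro l
      refine disjoint_left.2 fun x h1 h2 => ?_
      have := h1.2.2; have := h2.2.1; linarith
    have hsub : ∀ l ≤ a + h, Ioc a l ×ˢ Ioc b (b + h) ⊆ S := fun l hl =>
      prod_mono (Ioc_subset_Ioc_right hl) Subset.rfl
    have hsplit : ∀ l ≤ a + h, ∫ x in Ioc a l ×ˢ Ioc b (b + h), |v x| =
        (∫ x in Ioc a l ×ˢ Ioc b (b + h / 2), |v x|) +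
          ∫ x in Ioc a l ×ˢ Ioc (b + h / 2) (b + h / 2 + h / 2), |v x| := by
      intro l hl
      have hi : IntegrableOn (fun x => |v x|) (Ioc a l ×ˢ Ioc b (b + h)) :=
        Integrable.abs (hv.mono_set ((hsub l hl).trans hQ))
      rw [hu l] at hi ⊢
      exact setIntegral_union (hdis l) (measurableSet_Ioc.prod measurableSet_Ioc)
        (hi.mono_set subset_union_left) (hi.mono_set subset_union_right)
    have s12 : S1 ∪ S2 ⊆ S := by rw [← hu]; exact hsub _ (by linarith)
    have i1 := ih (n + 1) a b (h / 2) h2 ((subset_union_left.trans s12).trans hQ)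
    have i2 := ih (n + 1) a (b + h / 2) (h / 2) h2 ((subset_union_right.trans s12).trans hQ)
    have hhalf := half_strip_le (a := a) (b := b) (p := r ^ n) hΛ k0 hp (by positivity) hm
      (hv.mono_set hQ) (hk.mono_set (prod_mono hQ hQ)) fun x hx y hy => by
        rw [hh]
        refine hvk x (hQ hx) y (hQ hy) n ?_ ?_ <;> rw [← hh, abs_le]
        · have := hx.1.1; have := hx.1.2; have := hy.1.1; have := hy.1.2
          constructor <;> linarith
        · have := hx.2.1; have := hx.2.2; have := hy.2.1; have := hy.2.2
          constructor <;> linarith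
    have hG : (∫ z in S1 ×ˢ S1, k z) + (∫ z in S2 ×ˢ S2, k z) ≤ ∫ z in S ×ˢ S, k z := by
      have hkS := hk.mono_set (prod_mono hQ hQ)
      have m2 : MeasurableSet (S2 ×ˢ S2) := (measurableSet_Ioc.prod measurableSet_Ioc).prod
        (measurableSet_Ioc.prod measurableSet_Ioc)
      have t1 : S1 ×ˢ S1 ⊆ S ×ˢ S :=
        prod_mono (subset_union_left.trans s12) (subset_union_left.trans s12)
      have t2 : S2 ×ˢ S2 ⊆ S ×ˢ S :=
        prod_mono (subset_union_right.trans s12) (subset_union_right.trans s12)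
      rw [← setIntegral_union (disjoint_left.2 fun z h1 h2 => disjoint_left.1 (hdis _) h1.1 h2.1)
        m2 (hkS.mono_set t1) (hkS.mono_set t2)]
      exact setIntegral_mono_set hkS (Filter.Eventually.of_forall fun z => k0 z)
        (union_subset t1 t2).eventuallyLE
    rw [hsplit _ (by linarith)] at hhalf
    have e : h / 2 ^ (j + 1) = h / 2 / 2 ^ j := by rw [pow_succ]; field_simp
    rw [hsplit _ (by rw [add_le_add_iff_left]; exact div_le_self hp.le (one_le_pow₀ (by norm_num))), e]
    have e' : (2 : ℝ) ^ (j + 1) / h = 2 ^ j / (h / 2) := by rw [pow_succ]; field_simp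
    rw [e', mul_add]
    refine (add_le_add i1 i2).trans ?_
    set G1 := ∫ z in S1 ×ˢ S1, k z
    set G2 := ∫ z in S2 ×ˢ S2, k z
    set G := ∫ z in S ×ˢ S, k z
    set I1 := ∫ x in S1, |v x|
    set I2 := ∫ x in S2, |v x|
    set I := ∫ x in S, |v x|
    have h3 : m * r ^ n * (G1 + G2) ≤ m * r ^ n * G := by gcongr
    calc _ = 2 / h * (I1 + I2) + r / (1 - r) * (m * r ^ n * (G1 + G2) + Λ * (h * r ^ n) / m) := by
            rw [pow_succ]; field_simp; ring
      _ ≤ (1 / h * I + (m * r ^ n * G + Λ * (h * r ^ n) / m)) +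
          r / (1 - r) * (m * r ^ n * G + Λ * (h * r ^ n) / m) := by gcongr
      _ = _ := by field_simp; ring

end DyadicSquares

section TraceStrips

/-- The Gagliardo kernel on `ℝ²`. -/
def gagKernel (s : ℝ) (u : ℝ × ℝ → ℝ) (q : (ℝ × ℝ) × (ℝ × ℝ)) : ℝ :=
  (u q.1 - u q.2) ^ 2 / ((q.1.1 - q.2.1) ^ 2 + (q.1.2 - q.2.2) ^ 2) ^ ((2 + 2 * s) / 2)

/-- The constant in the trace estimate on thin strips. -/
def stripConst (s : ℝ) : ℝ := 2 + 1 / (1 - (1 / 2) ^ (s - 1 / 2)) * (1 + 5 ^ ((2 + 2 * s) / 2))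

variable {s : ℝ} {u : ℝ × ℝ → ℝ}

theorem half_rpow_lt_one (hs : 1 / 2 < s) : ((1 / 2 : ℝ)) ^ (s - 1 / 2) < 1 :=
  Real.rpow_lt_one (by norm_num) (by norm_num) (by linarith)

theorem stripConst_pos (hs : 1 / 2 < s) : 0 < stripConst s := by
  have := sub_pos.2 (half_rpow_lt_one hs)
  rw [stripConst]
  positivity

theorem gagKernel_nonneg (q : (ℝ × ℝ) × (ℝ × ℝ)) : 0 ≤ gagKernel s u q := by
  rw [gagKernel]; positivity

theorem sq_sub_le_gagKernel (hs : 0 < s) (x y : ℝ × ℝ) {R : ℝ}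
    (hR : (x.1 - y.1) ^ 2 + (x.2 - y.2) ^ 2 ≤ R) :
    (u x - u y) ^ 2 ≤ R ^ ((2 + 2 * s) / 2) * gagKernel s u (x, y) := by
  rw [gagKernel]
  set D := (x.1 - y.1) ^ 2 + (x.2 - y.2) ^ 2 with hD
  have hD0 : 0 ≤ D := by positivity
  rcases hD0.eq_or_lt with h | h
  · have h1 : x.1 = y.1 := by nlinarith [sq_nonneg (x.1 - y.1), sq_nonneg (x.2 - y.2)]
    have h2 : x.2 = y.2 := by nlinarith [sq_nonneg (x.1 - y.1), sq_nonneg (x.2 - y.2)]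
    rw [Prod.ext h1 h2]
    simp
  · have hp : 0 < D ^ ((2 + 2 * s) / 2) := Real.rpow_pos_of_pos h _
    rw [mul_div_assoc', le_div_iff₀ hp, mul_comm]
    gcongr

theorem gag2Sq_eq_setIntegral (hg : IntegrableOn (gagKernel s u) (That ×ˢ That)) :
    gag2Sq s That u = ∫ q in That ×ˢ That, gagKernel s u q := by
  rw [Measure.volume_eq_prod] at hg ⊢
  rw [setIntegral_prod _ hg]
  rfl

theorem strip_flux_le (hs : 1 / 2 < s) (hu : IntegrableOn u That)
    (hu2 : IntegrableOn (fun x => u x ^ 2) That)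
    (hg : IntegrableOn (gagKernel s u) (That ×ˢ That)) {M : ℝ × ℝ → ℝ × ℝ} (hM : Continuous M)
    (hinj : Function.Injective M) (hmp : MeasurePreserving M)
    (hMT : ∀ x ∈ Ioo (0 : ℝ) (1 / 2) ×ˢ Ioo (0 : ℝ) (1 / 2), M x ∈ That)
    (hML : ∀ x y h, |x.1 - y.1| ≤ h → |x.2 - y.2| ≤ h →
      ((M x).1 - (M y).1) ^ 2 + ((M x).2 - (M y).2) ^ 2 ≤ 5 * h ^ 2)
    (j : ℕ) {B : Set (ℝ × ℝ)}
    (hB : M ⁻¹' B ⊆ Ioc (0 : ℝ) (1 / 2 ^ (j + 1)) ×ˢ Ioc (0 : ℝ) (1 / 2)) :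
    2 ^ (j + 1) * ∫ x in B, |u x| ≤ stripConst s * HsNorm s u := by
  have hs0 : 0 < s := by linarith
  set r : ℝ := (1 / 2) ^ (s - 1 / 2) with hr
  have hr0 : 0 < r := by positivity
  have hr1 : r < 1 := half_rpow_lt_one hs
  have hr' := sub_pos.2 hr1
  set Λ : ℝ := 5 ^ ((2 + 2 * s) / 2) with hΛ
  have hΛ0 : 0 < Λ := by positivity
  have hemb : MeasurableEmbedding M := hM.measurableEmbedding hinj
  set Q := Ioc (0 : ℝ) (1 / 2) ×ˢ Ioc (0 : ℝ) (1 / 2) with hQ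
  set Q' := Ioo (0 : ℝ) (1 / 2) ×ˢ Ioo (0 : ℝ) (1 / 2) with hQ'
  have hQQ : Q' =ᵐ[volume] Q := Measure.set_prod_ae_eq Ioo_ae_eq_Ioc Ioo_ae_eq_Ioc
  have hQQ2 : Q' ×ˢ Q' =ᵐ[volume] Q ×ˢ Q := Measure.set_prod_ae_eq hQQ hQQ
  have hQT : Q' ⊆ M ⁻¹' That := hMT
  have hmp2 : MeasurePreserving (Prod.map M M) := hmp.prod hmp
  have hemb2 : MeasurableEmbedding (Prod.map M M) :=
    (hM.prodMap hM).measurableEmbedding (hinj.prodMap hinj)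
  have hQT2 : Q' ×ˢ Q' ⊆ Prod.map M M ⁻¹' (That ×ˢ That) := fun z hz => ⟨hMT _ hz.1, hMT _ hz.2⟩
  have iv' : IntegrableOn (u ∘ M) (M ⁻¹' That) := (hmp.integrableOn_comp_preimage hemb).2 hu
  have ik' : IntegrableOn (gagKernel s u ∘ Prod.map M M) (Prod.map M M ⁻¹' (That ×ˢ That)) :=
    (hmp2.integrableOn_comp_preimage hemb2).2 hg
  have iv : IntegrableOn (u ∘ M) Q := (iv'.mono_set hQT).congr_set_ae hQQ.symm
  have ik : IntegrableOn (gagKernel s u ∘ Prod.map M M) (Q ×ˢ Q) :=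
    (ik'.mono_set hQT2).congr_set_ae hQQ2.symm
  have hvk : ∀ x ∈ Q, ∀ y ∈ Q, ∀ n : ℕ, |x.1 - y.1| ≤ (1 / 2) ^ n → |x.2 - y.2| ≤ (1 / 2) ^ n →
      ((u ∘ M) x - (u ∘ M) y) ^ 2 ≤ Λ * ((1 / 2) ^ n) ^ 3 * (r ^ n) ^ 2 *
        (gagKernel s u ∘ Prod.map M M) (x, y) := by
    intro x _ y _ n h1 h2
    refine (sq_sub_le_gagKernel hs0 (M x) (M y) (hML x y _ h1 h2)).trans_eq ?_
    have hh : (0 : ℝ) < (1 / 2) ^ n := by positivity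
    congr 1
    rw [Real.mul_rpow (by norm_num) (by positivity), mul_assoc]
    congr 1
    have e : r ^ n = ((1 / 2 : ℝ) ^ n) ^ (s - 1 / 2) := by
      rw [hr, ← Real.rpow_natCast, ← Real.rpow_natCast, ← Real.rpow_mul (by norm_num),
        ← Real.rpow_mul (by norm_num), mul_comm]
    rw [e, ← Real.rpow_natCast _ 2, ← Real.rpow_natCast _ 3, ← Real.rpow_natCast _ 2,
      ← Real.rpow_mul hh.le, ← Real.rpow_mul hh.le, ← Real.rpow_add hh]
    congr 1
    push_cast
    ring
  set G := gag2Sq s That u with hG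
  have hG0 : 0 ≤ G := by
    rw [hG, gag2Sq_eq_setIntegral hg]
    exact integral_nonneg fun z => gagKernel_nonneg z
  have hkG : ∫ z in Q ×ˢ Q, (gagKernel s u ∘ Prod.map M M) z ≤ G := by
    rw [hG, gag2Sq_eq_setIntegral hg, ← hmp2.setIntegral_preimage_emb hemb2 _ (That ×ˢ That),
      ← setIntegral_congr_set hQQ2]
    exact setIntegral_mono_set ik' (Filter.Eventually.of_forall fun z => gagKernel_nonneg _)
      hQT2.eventuallyLE
  have hvI : ∫ z in Q, |(u ∘ M) z| ≤ √(∫ x in That, u x ^ 2) := by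
    have h1 : ∫ z in Q, |(u ∘ M) z| ≤ ∫ x in That, |u x| := by
      rw [← hmp.setIntegral_preimage_emb hemb _ That, ← setIntegral_congr_set hQQ]
      exact setIntegral_mono_set iv'.abs (Filter.Eventually.of_forall fun z => abs_nonneg _)
        hQT.eventuallyLE
    refine h1.trans ((le_abs_self _).trans ((abs_integral_le_sqrt_mul_sqrt hu.abs
      (by simp only [sq_abs]; exact hu2)).trans ?_))
    simp only [sq_abs]
    exact mul_le_of_le_one_left (Real.sqrt_nonneg _)
      ((Real.sqrt_le_sqrt measureReal_That_le).trans_eq Real.sqrt_one)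
  have hBQ : ∫ x in B, |u x| ≤ ∫ z in Ioc (0 : ℝ) (1 / 2 / 2 ^ j) ×ˢ Ioc (0 : ℝ) (1 / 2),
      |(u ∘ M) z| := by
    have e : (1 / 2 / 2 ^ j : ℝ) = 1 / 2 ^ (j + 1) := by rw [pow_succ]; field_simp
    rw [← hmp.setIntegral_preimage_emb hemb _ B, e]
    refine setIntegral_mono_set ((iv.mono_set (prod_mono (Ioc_subset_Ioc_right ?_)
      Subset.rfl)).abs) (Filter.Eventually.of_forall fun z => abs_nonneg _) hB.eventuallyLE
    rw [← e]
    exact div_le_self (by norm_num) (one_le_pow₀ (by norm_num))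
  have hfin : ∀ γ > √G, 2 ^ (j + 1) * ∫ x in B, |u x| ≤
      2 * √(∫ x in That, u x ^ 2) + 1 / (1 - r) * ((1 + Λ) * γ) := by
    intro γ hγ
    have hγ0 : 0 < γ := (Real.sqrt_nonneg _).trans_lt hγ
    have key := dyadic_strip_le hΛ0.le (fun z => gagKernel_nonneg _) hr0 hr1 iv ik hvk
      (m := 1 / γ) (by positivity) j 1 0 0 (1 / 2) (by norm_num) (by simp [hQ])
    simp only [zero_add, pow_one] at key
    have e : (2 : ℝ) ^ j / (1 / 2) = 2 ^ (j + 1) := by rw [pow_succ]; field_simp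
    rw [e] at key
    refine (mul_le_mul_of_nonneg_left hBQ (by positivity)).trans (key.trans ?_)
    have hGγ : G ≤ γ ^ 2 := by
      rw [← Real.sq_sqrt hG0]; gcongr
    have h3 : 1 / γ * r * ∫ z in Q ×ˢ Q, (gagKernel s u ∘ Prod.map M M) z ≤ γ := by
      have h0 : 0 ≤ ∫ z in Q ×ˢ Q, (gagKernel s u ∘ Prod.map M M) z :=
        integral_nonneg fun z => gagKernel_nonneg _
      calc _ ≤ 1 / γ * 1 * γ ^ 2 := by gcongr; exact hkG.trans hGγ
        _ = γ := by field_simp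
    have h4 : Λ * (1 / 2 * r) / (1 / γ) ≤ Λ * γ := by
      rw [div_div_eq_mul_div, div_one]
      gcongr
      nlinarith
    have h5 : (1 : ℝ) / (1 / 2) = 2 := by norm_num
    rw [h5]
    gcongr
    rw [add_mul, one_mul]
    exact add_le_add h3 h4
  have hlim : 2 ^ (j + 1) * ∫ x in B, |u x| ≤
      2 * √(∫ x in That, u x ^ 2) + 1 / (1 - r) * ((1 + Λ) * √G) := by
    refine ge_of_tendsto (f := fun γ => 2 * √(∫ x in That, u x ^ 2) + 1 / (1 - r) * ((1 + Λ) * γ))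
      (x := nhdsWithin √G (Ioi √G)) ?_ ?_
    · exact Filter.Tendsto.mono_left (Continuous.tendsto (by fun_prop) _) nhdsWithin_le_nhds
    · filter_upwards [self_mem_nhdsWithin] with γ hγ using hfin γ hγ
  refine hlim.trans ?_
  rw [stripConst, HsNorm, ← hr, ← hΛ, ← hG]
  have h1 := Real.sqrt_nonneg (∫ x in That, u x ^ 2)
  have h2 := Real.sqrt_nonneg G
  have h3 : 0 ≤ 1 / (1 - r) * (1 + Λ) := by positivity
  nlinarith [mul_nonneg h3 h1]

end TraceStrips

section TraceEdges

variable {s : ℝ} {u : ℝ × ℝ → ℝ}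

theorem setIntegral_union_le_of_halves {B P : Set (ℝ × ℝ)} (hu : IntegrableOn u B)
    (hP : MeasurableSet P) {c K : ℝ} (h1 : c * ∫ x in B ∩ P, |u x| ≤ K)
    (h2 : c * ∫ x in B \ P, |u x| ≤ K) : c * ∫ x in B, |u x| ≤ 2 * K := by
  rw [← integral_inter_add_sdiff hP hu.abs, mul_add]
  linarith

theorem measurePreserving_shear {f : ℝ → ℝ} (hf : MeasurePreserving f) {g : ℝ → ℝ → ℝ}
    (hg : Measurable (Function.uncurry g)) (hgm : ∀ a, MeasurePreserving (g a)) :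
    MeasurePreserving (fun p : ℝ × ℝ => (f p.1, g p.1 p.2)) :=
  hf.skew_product hg (Filter.Eventually.of_forall fun a => (hgm a).map_eq)

theorem measurePreserving_shear_swap {f : ℝ → ℝ} (hf : MeasurePreserving f) {g : ℝ → ℝ → ℝ}
    (hg : Measurable (Function.uncurry g)) (hgm : ∀ a, MeasurePreserving (g a)) :
    MeasurePreserving (fun p : ℝ × ℝ => (g p.1 p.2, f p.1)) :=
  (Measure.measurePreserving_swap (μ := (volume : Measure ℝ)) (ν := (volume : Measure ℝ))).comp
    (measurePreserving_shear hf hg hgm)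

theorem right_strip_le (hs : 1 / 2 < s) (hu : IntegrableOn u That)
    (hu2 : IntegrableOn (fun x => u x ^ 2) That)
    (hg : IntegrableOn (gagKernel s u) (That ×ˢ That)) (j : ℕ) :
    2 ^ (j + 1) * ∫ x in That ∩ {x | 1 - x.1 < 1 / 2 ^ (j + 1)}, |u x| ≤
      2 * (stripConst s * HsNorm s u) := by
  have hsub : MeasurePreserving fun t : ℝ => 1 - t := Measure.measurePreserving_sub_left volume 1
  refine setIntegral_union_le_of_halves (P := {x | x.2 ≤ 1 / 2}) (hu.mono_set inter_subset_left)
    (measurableSet_le measurable_snd measurable_const)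
    (strip_flux_le hs hu hu2 hg (M := fun p => (1 - p.1, p.2)) (by fun_prop) ?_
      (measurePreserving_shear hsub (g := fun _ b => b) (by fun_prop)
        fun _ => MeasurePreserving.id _) ?_ ?_ j ?_)
    (strip_flux_le hs hu hu2 hg (M := fun p => (1 - p.1, 1 - p.1 - p.2)) (by fun_prop) ?_
      (measurePreserving_shear hsub (g := fun a b => 1 - a - b) (by fun_prop)
        fun a => Measure.measurePreserving_sub_left volume (1 - a)) ?_ ?_ j ?_)
  · rintro ⟨a, b⟩ ⟨a', b'⟩ h
    simp only [Prod.mk.injEq] at h ⊢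
    constructor <;> linarith
  · rintro ⟨a, b⟩ ⟨⟨h1, h2⟩, h3, h4⟩
    refine ⟨?_, ?_, ?_, ?_⟩ <;> simp only at * <;> linarith
  · intro x y h h1 h2
    have := sq_le_sq' (abs_le.1 h1).1 (abs_le.1 h1).2
    have := sq_le_sq' (abs_le.1 h2).1 (abs_le.1 h2).2
    simp only
    nlinarith [sq_nonneg h]
  · rintro ⟨a, b⟩ ⟨⟨⟨h1, h2, h3, h4⟩, h5⟩, h6⟩
    simp only [mem_ofPred_eq] at *
    refine ⟨⟨?_, ?_⟩, ?_, ?_⟩ <;> simp only at * <;> linarith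
  · rintro ⟨a, b⟩ ⟨a', b'⟩ h
    simp only [Prod.mk.injEq] at h ⊢
    constructor <;> linarith
  · rintro ⟨a, b⟩ ⟨⟨h1, h2⟩, h3, h4⟩
    refine ⟨?_, ?_, ?_, ?_⟩ <;> simp only at * <;> linarith
  · intro x y h h1 h2
    have := sq_le_sq' (abs_le.1 h1).1 (abs_le.1 h1).2
    have := sq_le_sq' (abs_le.1 h2).1 (abs_le.1 h2).2
    simp only
    nlinarith [sq_nonneg (x.1 - y.1 - (x.2 - y.2))]
  · rintro ⟨a, b⟩ ⟨⟨⟨h1, h2, h3, h4⟩, h5⟩, h6⟩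
    simp only [mem_ofPred_eq, not_le] at *
    refine ⟨⟨?_, ?_⟩, ?_, ?_⟩ <;> simp only at * <;> linarith

theorem bottom_strip_le (hs : 1 / 2 < s) (hu : IntegrableOn u That)
    (hu2 : IntegrableOn (fun x => u x ^ 2) That)
    (hg : IntegrableOn (gagKernel s u) (That ×ˢ That)) (j : ℕ) :
    2 ^ (j + 1) * ∫ x in That ∩ {x | x.2 < 1 / 2 ^ (j + 1)}, |u x| ≤
      2 * (stripConst s * HsNorm s u) := by
  have hid : MeasurePreserving fun t : ℝ => t := MeasurePreserving.id _
  refine setIntegral_union_le_of_halves (P := {x | 1 / 2 ≤ x.1}) (hu.mono_set inter_subset_left)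
    (measurableSet_le measurable_const measurable_fst)
    (strip_flux_le hs hu hu2 hg (M := fun p => (1 - p.2, p.1)) (by fun_prop) ?_
      (measurePreserving_shear_swap hid (g := fun _ b => 1 - b) (by fun_prop)
        fun _ => Measure.measurePreserving_sub_left volume 1) ?_ ?_ j ?_)
    (strip_flux_le hs hu hu2 hg (M := fun p => (p.1 + p.2, p.1)) (by fun_prop) ?_
      (measurePreserving_shear_swap hid (g := fun a b => a + b) (by fun_prop)
        fun a => measurePreserving_add_left volume a) ?_ ?_ j ?_)
  · rintro ⟨a, b⟩ ⟨a', b'⟩ h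
    simp only [Prod.mk.injEq] at h ⊢
    constructor <;> linarith
  · rintro ⟨a, b⟩ ⟨⟨h1, h2⟩, h3, h4⟩
    refine ⟨?_, ?_, ?_, ?_⟩ <;> simp only at * <;> linarith
  · intro x y h h1 h2
    have := sq_le_sq' (abs_le.1 h1).1 (abs_le.1 h1).2
    have := sq_le_sq' (abs_le.1 h2).1 (abs_le.1 h2).2
    simp only
    nlinarith [sq_nonneg h]
  · rintro ⟨a, b⟩ ⟨⟨⟨h1, h2, h3, h4⟩, h5⟩, h6⟩
    simp only [mem_ofPred_eq] at *
    refine ⟨⟨?_, ?_⟩, ?_, ?_⟩ <;> simp only at * <;> linarith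
  · rintro ⟨a, b⟩ ⟨a', b'⟩ h
    simp only [Prod.mk.injEq] at h ⊢
    constructor <;> linarith
  · rintro ⟨a, b⟩ ⟨⟨h1, h2⟩, h3, h4⟩
    refine ⟨?_, ?_, ?_, ?_⟩ <;> simp only at * <;> linarith
  · intro x y h h1 h2
    have := sq_le_sq' (abs_le.1 h1).1 (abs_le.1 h1).2
    have := sq_le_sq' (abs_le.1 h2).1 (abs_le.1 h2).2
    simp only
    nlinarith [sq_nonneg (x.1 - y.1 - (x.2 - y.2))]
  · rintro ⟨a, b⟩ ⟨⟨⟨h1, h2, h3, h4⟩, h5⟩, h6⟩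
    simp only [mem_ofPred_eq, not_le] at *
    refine ⟨⟨?_, ?_⟩, ?_, ?_⟩ <;> simp only at * <;> linarith

end TraceEdges

section MeasurabilityOfFields

open Filter

/-- If the inner products `U x · U y` of a planar field are measurable on the product, then
the field itself is measurable. -/
theorem aestronglyMeasurable_of_prod {X : Type*} [MeasurableSpace X] {ν : Measure X} [SFinite ν]
    {u1 u2 : X → ℝ}
    (h : AEStronglyMeasurable (fun q : X × X => u1 q.1 * u1 q.2 + u2 q.1 * u2 q.2) (ν.prod ν)) :
    AEStronglyMeasurable u1 ν ∧ AEStronglyMeasurable u2 ν := by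
  have hW : ∀ᵐ x ∂ν, AEStronglyMeasurable (fun y => u1 x * u1 y + u2 x * u2 y) ν := h.prodMk_left
  by_cases hdet : ∃ a b c d : ℝ, a * d - b * c ≠ 0 ∧
      AEStronglyMeasurable (fun y => a * u1 y + b * u2 y) ν ∧
      AEStronglyMeasurable (fun y => c * u1 y + d * u2 y) ν
  · obtain ⟨a, b, c, d, hne, h1, h2⟩ := hdet
    constructor
    · refine (((h1.const_mul d).sub (h2.const_mul b)).const_mul (a * d - b * c)⁻¹).congr
        (Eventually.of_forall fun y => ?_)
      simp only [Pi.sub_apply]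
      field_simp
      ring
    · refine (((h2.const_mul a).sub (h1.const_mul c)).const_mul (a * d - b * c)⁻¹).congr
        (Eventually.of_forall fun y => ?_)
      simp only [Pi.sub_apply]
      field_simp
      ring
  · push Not at hdet
    by_cases hz : ∃ p q : ℝ, p ^ 2 + q ^ 2 ≠ 0 ∧
        AEStronglyMeasurable (fun y => p * u1 y + q * u2 y) ν
    · obtain ⟨p, q, hne, hg⟩ := hz
      have hpar : ∀ᵐ x ∂ν, p * u2 x - q * u1 x = 0 := by
        filter_upwards [hW] with x hx
        by_contra hc
        exact hdet p q _ _ hc hg hx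
      constructor
      · refine (hg.const_mul (p / (p ^ 2 + q ^ 2))).congr ?_
        filter_upwards [hpar] with x hx
        field_simp
        linear_combination q * hx
      · refine (hg.const_mul (q / (p ^ 2 + q ^ 2))).congr ?_
        filter_upwards [hpar] with x hx
        field_simp
        linear_combination -p * hx
    · push Not at hz
      have h0 : ∀ᵐ x ∂ν, u1 x ^ 2 + u2 x ^ 2 = 0 := by
        filter_upwards [hW] with x hx
        by_contra hc
        exact hz _ _ hc hx
      constructor
      · refine (aestronglyMeasurable_const (b := (0 : ℝ))).congr ?_
        filter_upwards [h0] with x hx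
        nlinarith [sq_nonneg (u1 x), sq_nonneg (u2 x)]
      · refine (aestronglyMeasurable_const (b := (0 : ℝ))).congr ?_
        filter_upwards [h0] with x hx
        nlinarith [sq_nonneg (u1 x), sq_nonneg (u2 x)]

variable {s : ℝ} {u1 u2 dv : ℝ × ℝ → ℝ}

theorem aestronglyMeasurable_of_gagliardo (hs : 0 < s)
    (h1 : IntegrableOn (fun x => u1 x ^ 2) That) (h2 : IntegrableOn (fun x => u2 x ^ 2) That)
    (hg : IntegrableOn
        (fun q : (ℝ × ℝ) × (ℝ × ℝ) =>
          ((u1 q.1 - u1 q.2) ^ 2 + (u2 q.1 - u2 q.2) ^ 2) /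
            ((q.1.1 - q.2.1) ^ 2 + (q.1.2 - q.2.2) ^ 2) ^ ((2 + 2 * s) / 2))
        (That ×ˢ That)) :
    AEStronglyMeasurable u1 (volume.restrict That) ∧
      AEStronglyMeasurable u2 (volume.restrict That) := by
  refine aestronglyMeasurable_of_prod ?_
  have hg' := hg.aestronglyMeasurable
  rw [Measure.volume_eq_prod (ℝ × ℝ) (ℝ × ℝ), ← Measure.prod_restrict] at hg'
  have hD : Measurable (fun q : (ℝ × ℝ) × (ℝ × ℝ) =>
      ((q.1.1 - q.2.1) ^ 2 + (q.1.2 - q.2.2) ^ 2) ^ ((2 + 2 * s) / 2)) := by fun_prop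
  have hN := hg'.mul hD.aestronglyMeasurable
  have hU := h1.aestronglyMeasurable.add h2.aestronglyMeasurable
  refine (((hU.comp_fst.add hU.comp_snd).sub hN).const_mul (1 / 2)).congr
    (Eventually.of_forall fun q => ?_)
  simp only [Pi.sub_apply, Pi.add_apply, Pi.mul_apply]
  have e : (u1 q.1 - u1 q.2) ^ 2 + (u2 q.1 - u2 q.2) ^ 2 =
      ((u1 q.1 - u1 q.2) ^ 2 + (u2 q.1 - u2 q.2) ^ 2) /
            ((q.1.1 - q.2.1) ^ 2 + (q.1.2 - q.2.2) ^ 2) ^ ((2 + 2 * s) / 2) *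
        ((q.1.1 - q.2.1) ^ 2 + (q.1.2 - q.2.2) ^ 2) ^ ((2 + 2 * s) / 2) := by
    have k1 := sq_sub_le_gagKernel (u := u1) hs q.1 q.2 le_rfl
    have k2 := sq_sub_le_gagKernel (u := u2) hs q.1 q.2 le_rfl
    by_cases h0 : ((q.1.1 - q.2.1) ^ 2 + (q.1.2 - q.2.2) ^ 2) ^ ((2 + 2 * s) / 2) = 0
    · rw [h0] at k1 k2 ⊢
      nlinarith [sq_nonneg (u1 q.1 - u1 q.2), sq_nonneg (u2 q.1 - u2 q.2)]
    · rw [div_mul_cancel₀ _ h0]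
  rw [← e]
  ring

theorem integrableOn_gagKernel_of_le {u : ℝ × ℝ → ℝ}
    (hu : AEStronglyMeasurable u (volume.restrict That))
    {N : (ℝ × ℝ) × (ℝ × ℝ) → ℝ} (hN : ∀ q, (u q.1 - u q.2) ^ 2 ≤ N q)
    (hg : IntegrableOn (fun q : (ℝ × ℝ) × (ℝ × ℝ) =>
      N q / ((q.1.1 - q.2.1) ^ 2 + (q.1.2 - q.2.2) ^ 2) ^ ((2 + 2 * s) / 2)) (That ×ˢ That)) :
    IntegrableOn (gagKernel s u) (That ×ˢ That) := by
  have hD : Measurable (fun q : (ℝ × ℝ) × (ℝ × ℝ) =>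
      ((q.1.1 - q.2.1) ^ 2 + (q.1.2 - q.2.2) ^ 2) ^ ((2 + 2 * s) / 2)) := by fun_prop
  refine Integrable.mono' hg ?_ (Eventually.of_forall fun q => ?_)
  · rw [Measure.volume_eq_prod (ℝ × ℝ) (ℝ × ℝ), ← Measure.prod_restrict]
    exact ((hu.comp_fst.sub hu.comp_snd).pow 2).mul hD.inv.aestronglyMeasurable
  · rw [Real.norm_of_nonneg (gagKernel_nonneg q), gagKernel]
    gcongr
    exact hN q

end MeasurabilityOfFields

section Divergence

open Filter Topology

theorem IsOpen.exists_contDiff_cutoff_seq {E : Type*} [NormedAddCommGroup E] [NormedSpace ℝ E]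
    [FiniteDimensional ℝ E] {T : Set E} (hT : IsOpen T) (hb : Bornology.IsBounded T) :
    ∃ χ : ℕ → E → ℝ, (∀ n, ContDiff ℝ (⊤ : ℕ∞) (χ n) ∧ HasCompactSupport (χ n) ∧
      tsupport (χ n) ⊆ T) ∧ ∀ x ∈ T, ∀ᶠ n in atTop, χ n x = 1 := by
  obtain ⟨f, hf, hfd, hr⟩ := hT.exists_contDiff_support_eq (n := ⊤)
  have hsub : ∀ n : ℕ, tsupport (fun x => Real.smoothTransition (n * f x - 1)) ⊆ T := by
    intro n
    have hc : IsClosed {x | 1 ≤ (n : ℝ) * f x} :=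
      isClosed_le continuous_const (continuous_const.mul hfd.continuous)
    refine (closure_minimal (fun x hx => ?_) hc).trans fun x hx => ?_
    · by_contra h
      refine hx (Real.smoothTransition.zero_of_nonpos ?_)
      simp only [mem_ofPred_eq, not_le] at h
      linarith
    · rw [← hf]
      intro h0
      simp only [mem_ofPred_eq, h0, mul_zero] at hx
      linarith
  refine ⟨fun n x => Real.smoothTransition (n * f x - 1), fun n => ⟨?_, ?_, hsub n⟩, fun x hx => ?_⟩
  · exact Real.smoothTransition.contDiff.comp ((contDiff_const.mul hfd).sub contDiff_const)
  · exact Metric.isCompact_of_isClosed_isBounded (isClosed_tsupport _) (hb.subset (hsub n))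
  · have h0 : 0 < f x :=
      lt_of_le_of_ne (hr (mem_range_self x)).1 fun h => by
        rw [← hf] at hx; exact hx h.symm
    obtain ⟨N, hN⟩ := exists_nat_ge (2 / f x)
    filter_upwards [eventually_ge_atTop N] with n hn
    refine Real.smoothTransition.one_of_one_le ?_
    have : (N : ℝ) ≤ n := by exact_mod_cast hn
    have := (div_le_iff₀ h0).1 (hN.trans this)
    linarith

variable {u1 u2 dv : ℝ × ℝ → ℝ}

theorem integrableOn_dot_grad (i1 : IntegrableOn u1 That) (i2 : IntegrableOn u2 That)
    {ψ : ℝ × ℝ → ℝ} (hψ : ContDiff ℝ (⊤ : ℕ∞) ψ) (hc : HasCompactSupport ψ) :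
    IntegrableOn (fun x => u1 x * pd1 ψ x + u2 x * pd2 ψ x) That := by
  have iw : IntegrableOn (fun x => (u1 x, u2 x)) That := Integrable.prodMk i1 i2
  obtain ⟨B, hB⟩ := (hc.fderiv (𝕜 := ℝ)).exists_bound_of_continuous
    (hψ.continuous_fderiv (by simp))
  simp only [← clm_apply_eq_pd]
  refine Integrable.mono' (iw.norm.const_mul B) (aestronglyMeasurable_clm_apply
    (measurable_fderiv ℝ ψ).aestronglyMeasurable iw.aestronglyMeasurable)
    (Eventually.of_forall fun x => ?_)
  exact (ContinuousLinearMap.le_opNorm _ _).trans (by gcongr; exact hB x)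

/-- If the density `dv` of the weak divergence is not measurable, then the field is weakly
divergence free. -/
theorem integral_dot_grad_eq_zero (i1 : IntegrableOn u1 That) (i2 : IntegrableOn u2 That)
    (hdiv : ∀ ψ : ℝ × ℝ → ℝ, ContDiff ℝ (⊤ : ℕ∞) ψ → HasCompactSupport ψ → tsupport ψ ⊆ That →
        (∫ x in That, (u1 x * pd1 ψ x + u2 x * pd2 ψ x)) = -∫ x in That, dv x * ψ x)
    (hdv : ¬ AEStronglyMeasurable dv (volume.restrict That))
    {ψ : ℝ × ℝ → ℝ} (hψ : ContDiff ℝ (⊤ : ℕ∞) ψ) (hc : HasCompactSupport ψ)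
    (ht : tsupport ψ ⊆ That) :
    ∫ x in That, (u1 x * pd1 ψ x + u2 x * pd2 ψ x) = 0 := by
  have hbad : ∀ χ : ℝ × ℝ → ℝ, ContDiff ℝ (⊤ : ℕ∞) χ → HasCompactSupport χ → tsupport χ ⊆ That →
      ¬ AEStronglyMeasurable (fun x => dv x * χ x) (volume.restrict That) →
      ∫ x in That, (u1 x * pd1 χ x + u2 x * pd2 χ x) = 0 := by
    intro χ h1 h2 h3 h4
    rw [hdiv χ h1 h2 h3, integral_undef fun h => h4 h.aestronglyMeasurable, neg_zero]
  by_cases hm : AEStronglyMeasurable (fun x => dv x * ψ x) (volume.restrict That)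
  · obtain ⟨χ, hχ, h1⟩ := isOpen_That.exists_contDiff_cutoff_seq isBounded_That
    have : ∃ n, ¬ AEStronglyMeasurable (fun x => dv x * χ n x) (volume.restrict That) := by
      by_contra! h
      refine hdv (aestronglyMeasurable_of_tendsto_ae atTop h ?_)
      filter_upwards [ae_restrict_mem isOpen_That.measurableSet] with x hx
      refine tendsto_const_nhds.congr' ?_
      filter_upwards [h1 x hx] with n hn
      rw [hn, mul_one]
    obtain ⟨n, hn⟩ := this
    obtain ⟨c1, c2, c3⟩ := hχ n
    have hadd := hbad (fun x => ψ x + χ n x) (hψ.add c1) (hc.add c2)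
      ((tsupport_add ψ (χ n)).trans (union_subset ht c3)) fun h => hn <|
        (h.sub hm).congr (Eventually.of_forall fun x => by simp only [Pi.sub_apply]; ring)
    have hχ0 := hbad (χ n) c1 c2 c3 hn
    have e : ∀ x, u1 x * pd1 (fun x => ψ x + χ n x) x + u2 x * pd2 (fun x => ψ x + χ n x) x =
        (u1 x * pd1 ψ x + u2 x * pd2 ψ x) + (u1 x * pd1 (χ n) x + u2 x * pd2 (χ n) x) := by
      intro x
      have : fderiv ℝ (fun x => ψ x + χ n x) x = fderiv ℝ ψ x + fderiv ℝ (χ n) x :=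
        fderiv_fun_add (hψ.differentiable (by simp) x) (c1.differentiable (by simp) x)
      simp only [pd1, pd2, this, add_apply]
      ring
    simp only [e] at hadd
    rw [integral_add (integrableOn_dot_grad i1 i2 hψ hc) (integrableOn_dot_grad i1 i2 c1 c2), hχ0,
      add_zero] at hadd
    exact hadd
  · exact hbad ψ hψ hc ht hm

theorem integral_mul_eq_zero_of_forall_contDiff (hd : IntegrableOn (fun x => dv x ^ 2) That)
    (h0 : ∀ ψ : ℝ × ℝ → ℝ, ContDiff ℝ (⊤ : ℕ∞) ψ → HasCompactSupport ψ → tsupport ψ ⊆ That →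
        ∫ x in That, dv x * ψ x = 0) {φ : ℝ × ℝ → ℝ} (hφ : ContinuousOn φ That)
    (hi : IntegrableOn (fun x => dv x * φ x) That) : ∫ x in That, dv x * φ x = 0 := by
  set O := That ∩ φ ⁻¹' {0}ᶜ with hO
  have hOo : IsOpen O := hφ.isOpen_inter_preimage isOpen_That isOpen_compl_singleton
  have hOT : O ⊆ That := inter_subset_left
  have hm : AEStronglyMeasurable dv (volume.restrict O) := by
    have hφm : AEStronglyMeasurable φ (volume.restrict O) :=
      (hφ.mono hOT).aestronglyMeasurable hOo.measurableSet
    refine ((hi.mono_set hOT).aestronglyMeasurable.div₀ hφm).congr ?_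
    filter_upwards [ae_restrict_mem hOo.measurableSet] with x hx
    simp only [Pi.div_apply]
    exact mul_div_cancel_right₀ _ hx.2
  have hiO : IntegrableOn dv O := by
    have hc : IntegrableOn (fun _ => (1 : ℝ)) O := (integrable_const (1 : ℝ)).mono_measure
      (Measure.restrict_mono hOT le_rfl)
    refine Integrable.mono' ((hd.mono_set hOT).add hc) hm (Eventually.of_forall fun x => ?_)
    simp only [Pi.add_apply, Real.norm_eq_abs]
    nlinarith [sq_nonneg (|dv x| - 1), sq_abs (dv x), abs_nonneg (dv x)]
  have hae := hOo.ae_eq_zero_of_integral_contDiff_smul_eq_zero hiO.locallyIntegrableOn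
    fun g g1 g2 g3 => by
      rw [← h0 g g1 g2 (g3.trans hOT), ← integral_indicator isOpen_That.measurableSet]
      refine integral_congr_ae (Eventually.of_forall fun x => ?_)
      by_cases hx : x ∈ That
      · simp only [indicator_of_mem hx, smul_eq_mul, mul_comm]
      · simp only [indicator_of_notMem hx,
          image_eq_zero_of_notMem_tsupport fun h => hx (hOT (g3 h)), zero_smul]
  refine setIntegral_eq_zero_of_ae_eq_zero ?_
  filter_upwards [hae] with x hx hxT
  by_cases h : φ x = 0
  · rw [h, mul_zero]
  · rw [hx ⟨hxT, h⟩, zero_mul]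

end Divergence

section RaviartThomas

variable {s ε : ℝ} {u1 u2 dv φ1 φ2 φ3 : ℝ × ℝ → ℝ}

theorem sqrt_setIntegral_sq_le {f : ℝ × ℝ → ℝ} {K : ℝ} (hK : 0 ≤ K)
    (hf : ∀ x ∈ That, |f x| ≤ K) : √(∫ x in That, f x ^ 2) ≤ K := by
  refine Real.sqrt_le_left hK |>.2 ?_
  have h := norm_setIntegral_le_of_norm_le_const (μ := volume) (s := That) (f := fun x => f x ^ 2)
    (C := K ^ 2) (volume_That_le.trans_lt ENNReal.one_lt_top) fun x hx => by
      rw [norm_pow, Real.norm_eq_abs]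
      exact pow_le_pow_left₀ (abs_nonneg _) (hf x hx) 2
  have h1 := measureReal_That_le
  rw [measureReal_restrict_apply_univ] at h1
  exact (le_abs_self _).trans (h.trans (mul_le_of_le_one_right (by positivity) h1))

theorem raviartThomas_le_of_measurable (hs : 1 / 2 < s)
    (m1 : AEStronglyMeasurable u1 (volume.restrict That))
    (m2 : AEStronglyMeasurable u2 (volume.restrict That))
    (md : AEStronglyMeasurable dv (volume.restrict That))
    (h1 : IntegrableOn (fun x => u1 x ^ 2) That) (h2 : IntegrableOn (fun x => u2 x ^ 2) That)
    (hd : IntegrableOn (fun x => dv x ^ 2) That)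
    (g1 : IntegrableOn (gagKernel s u1) (That ×ˢ That))
    (g2 : IntegrableOn (gagKernel s u2) (That ×ˢ That))
    (hdiv : ∀ ψ : ℝ × ℝ → ℝ, ContDiff ℝ (⊤ : ℕ∞) ψ → HasCompactSupport ψ → tsupport ψ ⊆ That →
        (∫ x in That, (u1 x * pd1 ψ x + u2 x * pd2 ψ x)) = -∫ x in That, dv x * ψ x)
    (a1 : Adm ε u1 u2 dv φ1 1 0 0) (a2 : Adm ε u1 u2 dv φ2 0 1 0) (a3 : Adm ε u1 u2 dv φ3 0 0 1) :
    |pairing u1 u2 dv φ2| ≤ 4 * stripConst s * HsNorm s u1 ∧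
    |pairing u1 u2 dv φ1| ≤ 4 * stripConst s * HsNorm s u2 ∧
    |pairing u1 u2 dv φ1 + pairing u1 u2 dv φ2 + pairing u1 u2 dv φ3| ≤
      √(∫ x in That, dv x ^ 2) := by
  have D := greenData_That m1 m2 md h1 h2 hd hdiv
  have i1 := integrableOn_of_sq m1 h1
  have i2 := integrableOn_of_sq m2 h2
  refine ⟨?_, ?_, abs_add_pairing_le D hd a1 a2 a3⟩
  · exact (abs_pairing_right_le D a2 (right_strip_le hs i1 h1 g1)).trans_eq (by ring)
  · exact (abs_pairing_bottom_le D a1 (bottom_strip_le hs i2 h2 g2)).trans_eq (by ring)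

/-- Passing from `dv` to `0` in an admissible triple for which `dv` annihilates all continuous
functions. -/
theorem Adm.replace_zero {w1 w2 w3 : ℝ} {φ : ℝ × ℝ → ℝ} (a : Adm ε u1 u2 dv φ w1 w2 w3)
    (h : ∀ φ : ℝ × ℝ → ℝ, ContinuousOn φ That → IntegrableOn (fun x => dv x * φ x) That →
      ∫ x in That, dv x * φ x = 0) :
    Adm ε u1 u2 (fun _ => 0) φ w1 w2 w3 ∧
      pairing u1 u2 (fun _ => 0) φ = pairing u1 u2 dv φ := by
  refine ⟨⟨a.diff, a.cont, a.bottom, a.right, a.oblique, a.mem, a.memL2, a.int1, by simp⟩, ?_⟩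
  rw [pairing, pairing, h φ a.diff.continuousOn a.int2]
  simp

theorem abs_pairing_le_of_gagliardo (hs : 1 / 2 < s)
    (h1 : IntegrableOn (fun x => u1 x ^ 2) That) (h2 : IntegrableOn (fun x => u2 x ^ 2) That)
    (hd : IntegrableOn (fun x => dv x ^ 2) That)
    (hg : IntegrableOn
        (fun q : (ℝ × ℝ) × (ℝ × ℝ) =>
          ((u1 q.1 - u1 q.2) ^ 2 + (u2 q.1 - u2 q.2) ^ 2) /
            ((q.1.1 - q.2.1) ^ 2 + (q.1.2 - q.2.2) ^ 2) ^ ((2 + 2 * s) / 2))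
        (That ×ˢ That))
    (hdiv : ∀ ψ : ℝ × ℝ → ℝ, ContDiff ℝ (⊤ : ℕ∞) ψ → HasCompactSupport ψ → tsupport ψ ⊆ That →
        (∫ x in That, (u1 x * pd1 ψ x + u2 x * pd2 ψ x)) = -∫ x in That, dv x * ψ x)
    (a1 : Adm ε u1 u2 dv φ1 1 0 0) (a2 : Adm ε u1 u2 dv φ2 0 1 0) (a3 : Adm ε u1 u2 dv φ3 0 0 1) :
    |pairing u1 u2 dv φ2| ≤ 4 * stripConst s * HsNorm s u1 ∧
    |pairing u1 u2 dv φ1| ≤ 4 * stripConst s * HsNorm s u2 ∧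
    |pairing u1 u2 dv φ1 + pairing u1 u2 dv φ2 + pairing u1 u2 dv φ3| ≤
      √(∫ x in That, dv x ^ 2) := by
  obtain ⟨m1, m2⟩ := aestronglyMeasurable_of_gagliardo (by linarith) h1 h2 hg
  have g1 := integrableOn_gagKernel_of_le m1
    (fun q => le_add_of_nonneg_right (sq_nonneg (u2 q.1 - u2 q.2))) hg
  have g2 := integrableOn_gagKernel_of_le m2
    (fun q => le_add_of_nonneg_left (sq_nonneg (u1 q.1 - u1 q.2))) hg
  by_cases md : AEStronglyMeasurable dv (volume.restrict That)
  · exact raviartThomas_le_of_measurable hs m1 m2 md h1 h2 hd g1 g2 hdiv a1 a2 a3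
  · have i1 := integrableOn_of_sq m1 h1
    have i2 := integrableOn_of_sq m2 h2
    have hdiv0 : ∀ ψ : ℝ × ℝ → ℝ, ContDiff ℝ (⊤ : ℕ∞) ψ → HasCompactSupport ψ →
        tsupport ψ ⊆ That → ∫ x in That, (u1 x * pd1 ψ x + u2 x * pd2 ψ x) = 0 :=
      fun ψ k1 k2 k3 => integral_dot_grad_eq_zero i1 i2 hdiv md k1 k2 k3
    have hz : ∀ φ : ℝ × ℝ → ℝ, ContinuousOn φ That → IntegrableOn (fun x => dv x * φ x) That →
        ∫ x in That, dv x * φ x = 0 := fun φ k1 k2 =>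
      integral_mul_eq_zero_of_forall_contDiff hd
        (fun ψ l1 l2 l3 => by
          have := hdiv ψ l1 l2 l3
          rw [hdiv0 ψ l1 l2 l3] at this
          linarith) k1 k2
    obtain ⟨b1, e1⟩ := a1.replace_zero hz
    obtain ⟨b2, e2⟩ := a2.replace_zero hz
    obtain ⟨b3, e3⟩ := a3.replace_zero hz
    obtain ⟨k1, k2, k3⟩ := raviartThomas_le_of_measurable hs m1 m2 aestronglyMeasurable_const h1 h2
      (by simp) g1 g2 (fun ψ l1 l2 l3 => by rw [hdiv0 ψ l1 l2 l3]; simp) b1 b2 b3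
    rw [e1, e2, e3] at k3
    rw [e2] at k1
    rw [e1] at k2
    exact ⟨k1, k2, k3.trans (by simp)⟩

end RaviartThomas

/-- Componentwise `L²` stability of the lowest-order Raviart–Thomas interpolant on the
reference triangle for `s > 1/2` (Theorem 5.2(i)): if `u ∈ H^s(T̂)²` with
`div u ∈ L²(T̂)`, then the interpolant `(a,b)ᵀ + c(x₁,x₂)ᵀ`, whose coefficients are
determined by the edge fluxes `-b = ⟨u·n,1⟩_{ê₁}`, `a + c = ⟨u·n,1⟩_{ê₂}`,
`b - a = ⟨u·n,1⟩_{ê₃}` (via the Green pairing with admissible test functions),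
satisfies `‖(Π̂_RT u)_l‖_{L²(T̂)} ≤ C (‖u_l‖_{H^s(T̂)} + ‖div u‖_{L²(T̂)})`, `l = 1,2`. -/
theorem stmt19 (s ε : ℝ) (hs : 1 / 2 < s) (hs1 : s < 1) (hε0 : 0 < ε) (hε : ε < 1 / 2) :
    ∃ C > 0, ∀ u1 u2 dv : ℝ × ℝ → ℝ,
      -- u ∈ H^s(T̂)², div u ∈ L²(T̂)
      IntegrableOn (fun x => u1 x ^ 2) That →
      IntegrableOn (fun x => u2 x ^ 2) That →
      IntegrableOn (fun x => dv x ^ 2) That →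
      IntegrableOn
        (fun q : (ℝ × ℝ) × (ℝ × ℝ) =>
          ((u1 q.1 - u1 q.2) ^ 2 + (u2 q.1 - u2 q.2) ^ 2) /
            ((q.1.1 - q.2.1) ^ 2 + (q.1.2 - q.2.2) ^ 2) ^ ((2 + 2 * s) / 2))
        (That ×ˢ That) →
      -- dv is the distributional divergence of u
      (∀ ψ : ℝ × ℝ → ℝ, ContDiff ℝ (⊤ : ℕ∞) ψ → HasCompactSupport ψ → tsupport ψ ⊆ That →
        (∫ x in That, (u1 x * pd1 ψ x + u2 x * pd2 ψ x)) =
          -∫ x in That, dv x * ψ x) →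
      -- admissible test functions pinning the three edge fluxes
      ∀ φ1 φ2 φ3 : ℝ × ℝ → ℝ,
        Adm ε u1 u2 dv φ1 1 0 0 →
        Adm ε u1 u2 dv φ2 0 1 0 →
        Adm ε u1 u2 dv φ3 0 0 1 →
        -- with b = -⟨u·n,1⟩_{ê₁}, a = b - ⟨u·n,1⟩_{ê₃}, c = ⟨u·n,1⟩_{ê₂} - a :
        (Real.sqrt (∫ x in That,
            ((-(pairing u1 u2 dv φ1) - pairing u1 u2 dv φ3) +
              (pairing u1 u2 dv φ2 -
                (-(pairing u1 u2 dv φ1) - pairing u1 u2 dv φ3)) * x.1) ^ 2) ≤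
          C * (HsNorm s u1 + Real.sqrt (∫ x in That, dv x ^ 2))) ∧
        (Real.sqrt (∫ x in That,
            (-(pairing u1 u2 dv φ1) +
              (pairing u1 u2 dv φ2 -
                (-(pairing u1 u2 dv φ1) - pairing u1 u2 dv φ3)) * x.2) ^ 2) ≤
          C * (HsNorm s u2 + Real.sqrt (∫ x in That, dv x ^ 2))) := by
  refine ⟨4 * stripConst s + 1, by linarith [stripConst_pos hs], ?_⟩
  intro u1 u2 dv h1 h2 hd hg hdiv φ1 φ2 φ3 a1 a2 a3
  obtain ⟨k2, k1, k3⟩ := abs_pairing_le_of_gagliardo hs h1 h2 hd hg hdiv a1 a2 a3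
  have hS := stripConst_pos hs
  have hN : ∀ u, 0 ≤ HsNorm s u := fun u => by rw [HsNorm]; positivity
  have hD := Real.sqrt_nonneg (∫ x in That, dv x ^ 2)
  set F1 := pairing u1 u2 dv φ1
  set F2 := pairing u1 u2 dv φ2
  set F3 := pairing u1 u2 dv φ3
  have bound : ∀ u : ℝ × ℝ → ℝ, ∀ F t : ℝ, |F| ≤ 4 * stripConst s * HsNorm s u → |t| ≤ 1 →
      |F + (F1 + F2 + F3) * t| ≤
        (4 * stripConst s + 1) * (HsNorm s u + √(∫ x in That, dv x ^ 2)) := by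
    intro u F t hF ht
    have h3 : |(F1 + F2 + F3) * t| ≤ √(∫ x in That, dv x ^ 2) := by
      rw [abs_mul]
      exact (mul_le_of_le_one_right (abs_nonneg _) ht).trans k3
    have := abs_add_le F ((F1 + F2 + F3) * t)
    nlinarith [hN u, mul_nonneg hS.le hD]
  constructor
  · refine sqrt_setIntegral_sq_le (by have := hN u1; positivity) fun x hx => ?_
    have e : (-F1 - F3) + (F2 - (-F1 - F3)) * x.1 = F2 + (F1 + F2 + F3) * (x.1 - 1) := by ring
    rw [e]
    exact bound u1 F2 _ k2 (abs_le.2 ⟨by linarith [hx.1], by linarith [hx.2.1]⟩)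
  · refine sqrt_setIntegral_sq_le (by have := hN u2; positivity) fun x hx => ?_
    have e : -F1 + (F2 - (-F1 - F3)) * x.2 = -F1 + (F1 + F2 + F3) * x.2 := by ring
    rw [e]
    refine bound u2 (-F1) _ (by rwa [abs_neg]) (abs_le.2 ⟨?_, ?_⟩)
    · linarith [hx.2.2.1]
    · linarith [hx.2.1, hx.2.2.2]
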